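/- Recurrence relations of the Tratnik polynomials of q-Racah type: for all nonnegative integers x, y, i, j with x+y ≤ N and i+j ≤ N, one has (i) λ(x;c₁c₂)·T_{i,j}(x,y) = Σ_{ε∈{−1,0,+1}} Φ^{ε}(i+ε;c₁,c₂,c₃;N−j)·T_{i+ε,j}(x,y), and (ii) λ(y;c₃c₀)·T_{i,j}(x,y) = Σ_{ε,ε'∈{−1,0,+1}} A^{ε,ε'}_{i+ε,j+ε'}(c₁,c₂,c₃,c₄;N)·T_{i+ε,j+ε'}(x,y), where the superscripts of Φ and A are +, 0, − according as the shift is +1, 0, −1, and T with a negative index or with indices summing to more than N is 0. -/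

import Mathlib

noncomputable section
namespace qR

/-- q-Pochhammer symbol `(a;q)_k = ∏_{l<k} (1 - a qˡ)`. -/
def poch (q a : ℂ) (k : ℕ) : ℂ := ∏ l ∈ Finset.range k, (1 - a * q ^ l)

/-- q-binomial coefficient, zero outside `0 ≤ n ≤ N`. -/
def binom (q : ℂ) (N n : ℤ) : ℂ :=
  if 0 ≤ n ∧ n ≤ N then poch q q N.toNat / (poch q q n.toNat * poch q q (N - n).toNat) else 0

/-- Normalisation `Ω(n;c1,c2,c3;N)`; `s` and `t2` are the chosen square roots of `q` and `c2`,
so that `(q c2)^(n - N/2) = (s t2)^(2n - N)`. -/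
def Om (q s c1 c2 c3 t2 : ℂ) (N n : ℤ) : ℂ :=
  binom q N n * (1 - c2 * c3 * q ^ (2 * n + 1)) * poch q (q * c2) n.toNat
      * poch q (c1 * c2 * c3 * q ^ (N + 2)) n.toNat * poch q (q * c1) (N - n).toNat
    / ((s * t2) ^ (2 * n - N) * poch q (c2 * c3 * q ^ (n + 1)) (N + 1).toNat
        * poch q (q * c3) n.toNat)

/-- Normalised q-Racah polynomial `p_n(x;c1,c2,c3;N)`, with the convention that it
vanishes unless `0 ≤ n ≤ N` and `0 ≤ x ≤ N`. -/
def p (q s c1 c2 c3 t2 : ℂ) (N n x : ℤ) : ℂ :=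
  if 0 ≤ n ∧ n ≤ N ∧ 0 ≤ x ∧ x ≤ N then
    Om q s c1 c2 c3 t2 N n *
      ∑ k ∈ Finset.range (n.toNat + 1),
        poch q (q ^ (-n)) k * poch q (c2 * c3 * q ^ (n + 1)) k * poch q (q ^ (-x)) k
            * poch q (c1 * c2 * q ^ (x + 1)) k * q ^ k
          / (poch q (q * c2) k * poch q (c1 * c2 * c3 * q ^ (N + 2)) k
              * poch q (q ^ (-N)) k * poch q q k)
  else 0

/-- `ω_n(c) = (-1)^n c^{n/2} q^{n(n+1)/2}`, where `r` is the chosen square root of `c`. -/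
def om (q r : ℂ) (n : ℤ) : ℂ := (-1 : ℂ) ^ n * r ^ n * q ^ (n * (n + 1) / 2)

/-- `ξ_n(c1,c2) = ((qc1;q)_n/(qc2;q)_n) (c2/c1)^{n/2}`, where `t1, t2` are the chosen
square roots of `c1, c2`. -/
def xi (q c1 c2 t1 t2 : ℂ) (n : ℤ) : ℂ :=
  poch q (q * c1) n.toNat / poch q (q * c2) n.toNat * (t2 / t1) ^ n

/-- `λ(x;c) = -(1-q^{-x})(1-c q^{x+1})`. -/
def lam (q c : ℂ) (x : ℤ) : ℂ := -(1 - q ^ (-x)) * (1 - c * q ^ (x + 1))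

def PhiP (q c1 c2 c3 : ℂ) (N n : ℤ) : ℂ :=
  -c2 * q ^ (n - N) * (1 - q ^ n) * (1 - c1 * q ^ (N - n + 1)) * (1 - c2 * c3 * q ^ (n + N + 1))
      * (1 - c3 * q ^ n)
    / ((1 - c2 * c3 * q ^ (2 * n)) * (1 - c2 * c3 * q ^ (2 * n + 1)))

def PhiM (q c1 c2 c3 : ℂ) (N n : ℤ) : ℂ :=
  (1 - q ^ (n - N)) * (1 - c1 * c2 * c3 * q ^ (n + N + 2)) * (1 - c2 * q ^ (n + 1))
      * (1 - c2 * c3 * q ^ (n + 1))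
    / ((1 - c2 * c3 * q ^ (2 * n + 1)) * (1 - c2 * c3 * q ^ (2 * n + 2)))

/-- `Φ^ε(n;c1,c2,c3;N)`, where `ε = 1, -1, 0` selects `Φ⁺, Φ⁻, Φ⁰`. -/
def Phi (q c1 c2 c3 : ℂ) (N ε n : ℤ) : ℂ :=
  if ε = 1 then PhiP q c1 c2 c3 N n
  else if ε = -1 then PhiM q c1 c2 c3 N n
  else -PhiP q c1 c2 c3 N n - PhiM q c1 c2 c3 N n

/-- `λ₊(x;c1,c2,c3;N)`. -/
def lamP (q c1 c2 c3 : ℂ) (N x : ℤ) : ℂ :=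
  -(q ^ (-N - 1) / c3 - q ^ (-x)) * (1 - c1 * c2 * c3 * q ^ (N + x + 2))

/-- `λ₋(x;c1,c2,c3;N)`. -/
def lamM (q c1 c2 c3 : ℂ) (N x : ℤ) : ℂ :=
  -(q ^ (-N) - q ^ (-x)) * (1 - c1 * c2 * q ^ (N + x + 1))

def PhiPp (q sq c1 c2 c3 : ℂ) (N n : ℤ) : ℂ :=
  -sq * c2 * q ^ (2 * n - N - 1) * (1 - q ^ n) * (1 - c1 * q ^ (N - n + 1))
      * (1 - c1 * q ^ (N + 2 - n)) * (1 - c3 * q ^ n)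
    / ((1 - c2 * c3 * q ^ (2 * n)) * (1 - c2 * c3 * q ^ (2 * n + 1)))

def PhiPm (q sq c1 c2 c3 : ℂ) (N n : ℤ) : ℂ :=
  -((1 - c1 * c2 * c3 * q ^ (n + N + 2)) * (1 - c1 * c2 * c3 * q ^ (n + N + 3))
      * (1 - c2 * q ^ (n + 1)) * (1 - c2 * c3 * q ^ (n + 1)))
    / (c3 * q ^ (N + 1) * sq * (1 - c2 * c3 * q ^ (2 * n + 1)) * (1 - c2 * c3 * q ^ (2 * n + 2)))

def PhiP0 (q sq c1 c2 c3 : ℂ) (N n : ℤ) : ℂ :=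
  -PhiPp q sq c1 c2 c3 N n - PhiPm q sq c1 c2 c3 N n
    - (1 - c1 * c2 * q ^ (N + 2)) * (1 - c1 * c2 * c3 * q ^ (N + 2)) / (c3 * q ^ (N + 1) * sq)

def PhiMp (q sq c1 c2 c3 : ℂ) (N n : ℤ) : ℂ :=
  -sq * (1 - q ^ n) * (1 - c3 * q ^ n) * (1 - c2 * c3 * q ^ (n + N))
      * (1 - c2 * c3 * q ^ (n + N + 1))
    / (q ^ N * (1 - c2 * c3 * q ^ (2 * n)) * (1 - c2 * c3 * q ^ (2 * n + 1)))

def PhiMm (q sq c1 c2 c3 : ℂ) (N n : ℤ) : ℂ :=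
  -c3 * sq * q ^ N * (1 - q ^ (n - N)) * (1 - q ^ (n - N + 1)) * (1 - c2 * q ^ (n + 1))
      * (1 - c2 * c3 * q ^ (n + 1))
    / ((1 - c2 * c3 * q ^ (2 * n + 1)) * (1 - c2 * c3 * q ^ (2 * n + 2)))

def PhiM0 (q sq c1 c2 c3 : ℂ) (N n : ℤ) : ℂ :=
  -PhiMp q sq c1 c2 c3 N n - PhiMm q sq c1 c2 c3 N n - sq * (1 - c3 * q ^ N) * (q ^ (-N) - 1)

/-- Contiguity coefficient `Φ_σ^ε(n;c1,c2,c3;N)`, where `σ = 1` is the `+` and `σ = -1`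
the `-` family, `ε ∈ {1,0,-1}` selects the superscript, and `sq` is the chosen square
root of `q c2`. -/
def PhiC (q sq c1 c2 c3 : ℂ) (σ ε N n : ℤ) : ℂ :=
  if σ = 1 then
    if ε = 1 then PhiPp q sq c1 c2 c3 N n
    else if ε = -1 then PhiPm q sq c1 c2 c3 N n
    else PhiP0 q sq c1 c2 c3 N n
  else
    if ε = 1 then PhiMp q sq c1 c2 c3 N n
    else if ε = -1 then PhiMm q sq c1 c2 c3 N n
    else PhiM0 q sq c1 c2 c3 N n

def Fp (q c1 c2 : ℂ) (x : ℤ) : ℂ :=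
  c1 * c2 ^ 2 * q ^ (x + 1) * (1 - c1 * q ^ x) * (1 - q ^ x)
    / ((1 - c1 * c2 * q ^ (2 * x)) * (1 - c1 * c2 * q ^ (2 * x + 1)))

def Fm (q c1 c2 : ℂ) (x : ℤ) : ℂ :=
  c1 * c2 * q ^ (x + 1) * (1 - c2 * q ^ (x + 1)) * (1 - c1 * c2 * q ^ (x + 1))
    / ((1 - c1 * c2 * q ^ (2 * x + 1)) * (1 - c1 * c2 * q ^ (2 * x + 2)))

/-- The coefficients `A^{ε,ε'}_{i,j}(c1,c2,c3,c4;N)` for `(ε,ε') ≠ (0,0)`;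
`t2` is the chosen square root of `c2` and the fifth parameter
`c0 = (q^{2N+3} c1 c2 c3 c4)⁻¹` is computed internally. -/
def Aaux (q s c1 c2 c3 c4 t2 : ℂ) (N ε ε' i j : ℤ) : ℂ :=
  if ε' = 1 ∨ ε' = -1 then
    -c3 * q ^ (N + 1) *
        (if ε' = 1 then Fp q c4 ((q ^ (2 * N + 3) * c1 * c2 * c3 * c4)⁻¹) j
         else Fm q c4 ((q ^ (2 * N + 3) * c1 * c2 * c3 * c4)⁻¹) j) *
        PhiC q (s * t2) c1 c2 c3 ε' ε (N - j) i
  else if ε = 1 ∨ ε = -1 then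
    c3 * q ^ (N + 1) *
        (Fp q c4 ((q ^ (2 * N + 3) * c1 * c2 * c3 * c4)⁻¹) j
          + Fm q c4 ((q ^ (2 * N + 3) * c1 * c2 * c3 * c4)⁻¹) j) *
        Phi q c1 c2 c3 (N - j) ε i
  else 0

/-- The coefficients `A^{ε,ε'}_{i,j}(c1,c2,c3,c4;N)`. -/
def A (q s c1 c2 c3 c4 t2 : ℂ) (N ε ε' i j : ℤ) : ℂ :=
  if ε = 0 ∧ ε' = 0 then
    -((1 - c3 * q ^ (N + 1 - j)) * (s * t2) / (1 - c1 * c2 * q ^ (N + 2 - j)))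
          * ∑ e ∈ ({-1, 0, 1} : Finset ℤ), Aaux q s c1 c2 c3 c4 t2 N e 1 i j
      - (1 - c1 * c2 * q ^ (N + 1 - j)) / ((1 - c3 * q ^ (N - j)) * (s * t2))
          * ∑ e ∈ ({-1, 0, 1} : Finset ℤ), Aaux q s c1 c2 c3 c4 t2 N e (-1) i j
      - ∑ e ∈ ({-1, 1} : Finset ℤ), Aaux q s c1 c2 c3 c4 t2 N e 0 i j
  else Aaux q s c1 c2 c3 c4 t2 N ε ε' i j

/-- `Λ(x;c1,c2,c3,c4;N)`; `s, t1, t2, t3, t4` are the chosen square roots of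
`q, c1, c2, c3, c4`. -/
def Lam (q s c1 c2 c3 c4 t1 t2 t3 t4 : ℂ) (N x : ℤ) : ℂ :=
  (-1 : ℂ) ^ x * binom q N x * (1 - c1 * c2 * q ^ (2 * x + 1)) * poch q (q * c2) x.toNat
      * (s * t2) ^ N * (t1 * t3 / (t2 * t4)) ^ x * q ^ (x * (x - 1) / 2)
    / (poch q (q * c1) x.toNat * poch q (q ^ (x + 1) * c1 * c2) (N + 1).toNat)

/-- Tratnik polynomial of q-Racah type `T_{i,j}(x,y;c1,c2,c3,c4;N)`; the fifth parameter
`c0 = (q^{2N+3} c1 c2 c3 c4)⁻¹` and its square root `t0 = (s^{2N+3} t1 t2 t3 t4)⁻¹`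
are computed internally. -/
def T (q s c1 c2 c3 c4 t1 t2 t3 t4 : ℂ) (N i j x y : ℤ) : ℂ :=
  if 0 ≤ i ∧ 0 ≤ j ∧ i + j ≤ N then
    p q s c1 c2 c3 t2 (N - j) i x *
      p q s c3 ((q ^ (2 * N + 3) * c1 * c2 * c3 * c4)⁻¹) c4
        ((s ^ (2 * N + 3) * t1 * t2 * t3 * t4)⁻¹) (N - x) j y
  else 0

/-- Griffiths polynomial of q-Racah type `G_{i,j}(x,y;c1,c2,c3,c4;N)`; the fifth parameter
`c0 = (q^{2N+3} c1 c2 c3 c4)⁻¹` and its square root `t0 = (s^{2N+3} t1 t2 t3 t4)⁻¹`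
are computed internally. -/
def G (q s c1 c2 c3 c4 t1 t2 t3 t4 : ℂ) (N i j x y : ℤ) : ℂ :=
  if 0 ≤ i ∧ 0 ≤ j ∧ i + j ≤ N then
    ∑ a ∈ Finset.range ((min (N - j) (N - y)).toNat + 1),
      om q (t1 * t2 * t3 / t4) (a : ℤ) * p q s c1 c2 c3 t2 (N - j) i (a : ℤ) *
        p q s c3 ((q ^ (2 * N + 3) * c1 * c2 * c3 * c4)⁻¹) c4
          ((s ^ (2 * N + 3) * t1 * t2 * t3 * t4)⁻¹) (N - (a : ℤ)) j y *
        p q s c4 c2 c1 t2 (N - y) (a : ℤ) x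
  else 0

end qR


namespace qR

set_option maxHeartbeats 1000000 in
set_option maxRecDepth 100000 in
theorem algR (q a b c U V W Z N0 Np Nm : ℂ) (hq : q ≠ 0) (hU : U ≠ 0) (hV : V ≠ 0) (hW : W ≠ 0)
    (h1 : 1 - b*c*U^2 ≠ 0) (h2 : 1 - b*c*q*U^2 ≠ 0) (h3 : 1 - b*c*q^2*U^2 ≠ 0)
    (h0 : N0 = Z * (1 - V/U) * (1 - b*c*q*U*V))
    (hp : Np * (1 - b*c*q*U) = Z * (1 - 1/(U*q)) * (1 - b*c*q*U*V) * (1 - b*c*q^2*U*V))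
    (hm : Nm * (1 - 1/U) = Z * (1 - V/U) * (1 - q*V/U) * (1 - b*c*U)) :
    - Z * ((1 - q*b*V) * (1 - a*b*c*q^2*W*V) * (1 - V/W) * (1 - q*V))
      + (-(1 - 1/(q*V)) * (1 - a*b*q^2*V)) * (N0 * (q*V))
    = q * V * (
       (1 - U/W)*(1-a*b*c*q^2*U*W)*(1-b*q*U)*(1-b*c*q*U)/((1-b*c*q*U^2)*(1-b*c*q^2*U^2)) * (Np - N0)
      + (-b*U/W*(1-U)*(1-a*q*W/U)*(1-b*c*q*U*W)*(1-c*U)/((1-b*c*U^2)*(1-b*c*q*U^2))) * (Nm - N0)) := by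
  have e1 : (1 - U/W)*(1-a*b*c*q^2*U*W)*(1-b*q*U)*(1-b*c*q*U)/((1-b*c*q*U^2)*(1-b*c*q^2*U^2)) * (Np - N0)
    = (1 - U/W)*(1-a*b*c*q^2*U*W)*(1-b*q*U)/((1-b*c*q*U^2)*(1-b*c*q^2*U^2)) * (Z * (1 - b*c*q*U*V)) * ((1 - 1/(U*q)) * (1 - b*c*q^2*U*V) - (1-b*c*q*U) * (1 - V/U)) := by
    rw [h0]; linear_combination ((1 - U/W)*(1-a*b*c*q^2*U*W)*(1-b*q*U)/((1-b*c*q*U^2)*(1-b*c*q^2*U^2))) * hp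
  have e2 : (-b*U/W*(1-U)*(1-a*q*W/U)*(1-b*c*q*U*W)*(1-c*U)/((1-b*c*U^2)*(1-b*c*q*U^2))) * (Nm - N0)
    = (b*U/W*U*(1-a*q*W/U)*(1-b*c*q*U*W)*(1-c*U)/((1-b*c*U^2)*(1-b*c*q*U^2))) * (Z * (1 - V/U)) * ((1 - q*V/U) * (1 - b*c*U) - (1-1/U) * (1 - b*c*q*U*V)) := by
    have : 1 - U = - U * (1 - 1/U) := by field_simp; ring
    rw [h0, this]; linear_combination ((b*U/W*U*(1-a*q*W/U)*(1-b*c*q*U*W)*(1-c*U)/((1-b*c*U^2)*(1-b*c*q*U^2)))) * hm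
  rw [e1, e2, h0]
  clear e1 e2 h0 hp hm
  generalize hd1 : 1 - b*c*U^2 = d1 at *
  generalize hd2 : 1 - b*c*q*U^2 = d2 at *
  generalize hd3 : 1 - b*c*q^2*U^2 = d3 at *
  field_simp
  rw [← hd1, ← hd2, ← hd3]
  ring

-- level C-: left level M-1, W = q^M
set_option maxHeartbeats 1000000 in
set_option maxRecDepth 100000 in
theorem algM (q a b c U V W Z N0 Np Nm : ℂ) (hq : q ≠ 0) (hU : U ≠ 0) (hV : V ≠ 0) (hW : W ≠ 0)
    (h1 : 1 - b*c*U^2 ≠ 0) (h2 : 1 - b*c*q*U^2 ≠ 0) (h3 : 1 - b*c*q^2*U^2 ≠ 0)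
    (h0 : N0 = Z * (1 - V/U) * (1 - b*c*q*U*V))
    (hp : Np * (1 - b*c*q*U) = Z * (1 - 1/(U*q)) * (1 - b*c*q*U*V) * (1 - b*c*q^2*U*V))
    (hm : Nm * (1 - 1/U) = Z * (1 - V/U) * (1 - q*V/U) * (1 - b*c*U)) :
    - Z * ((1 - a*b*c*q*V*W) * (1-q*b*V)*(1-a*b*c*q^2*V*W)*(1-1/W)*(1-q*V))
      + (1 - a*b*q^2*V*W) * N0 * ((1-a*b*c*q^2*V*W)*(1-1/W))
    = q * V * (
       (-((1-b*q*U)*(1-b*c*q*U)*(1-a*b*c*q*U*W)*(1-a*b*c*q^2*U*W)*(1-W))/(W*(1-b*c*q*U^2)*(1-b*c*q^2*U^2))) * (Np - N0)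
      + (-c*(q*b)^2*U^2/(W*q)*(1-U)*(1-c*U)*(1-a*q*W/U)*(1-a*W/U)*(1-W)/((1-b*c*U^2)*(1-b*c*q*U^2))) * (Nm - N0)
      + (-(1/W-1)*(1-a*b*q*W)) * (1-a*b*c*q*W) * N0) := by
  have e1 : (-((1-b*q*U)*(1-b*c*q*U)*(1-a*b*c*q*U*W)*(1-a*b*c*q^2*U*W)*(1-W))/(W*(1-b*c*q*U^2)*(1-b*c*q^2*U^2))) * (Np - N0)
    = (-((1-b*q*U)*(1-a*b*c*q*U*W)*(1-a*b*c*q^2*U*W)*(1-W))/(W*(1-b*c*q*U^2)*(1-b*c*q^2*U^2))) * (Z * (1 - b*c*q*U*V)) * ((1 - 1/(U*q)) * (1 - b*c*q^2*U*V) - (1-b*c*q*U) * (1 - V/U)) := by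
    rw [h0]; linear_combination ((-((1-b*q*U)*(1-a*b*c*q*U*W)*(1-a*b*c*q^2*U*W)*(1-W))/(W*(1-b*c*q*U^2)*(1-b*c*q^2*U^2)))) * hp
  have e2 : (-c*(q*b)^2*U^2/(W*q)*(1-U)*(1-c*U)*(1-a*q*W/U)*(1-a*W/U)*(1-W)/((1-b*c*U^2)*(1-b*c*q*U^2))) * (Nm - N0)
    = (c*(q*b)^2*U^2/(W*q)*U*(1-c*U)*(1-a*q*W/U)*(1-a*W/U)*(1-W)/((1-b*c*U^2)*(1-b*c*q*U^2))) * (Z * (1 - V/U)) * ((1 - q*V/U) * (1 - b*c*U) - (1-1/U) * (1 - b*c*q*U*V)) := by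
    have : 1 - U = - U * (1 - 1/U) := by field_simp; ring
    rw [h0, this]; linear_combination (c*(q*b)^2*U^2/(W*q)*U*(1-c*U)*(1-a*q*W/U)*(1-a*W/U)*(1-W)/((1-b*c*U^2)*(1-b*c*q*U^2))) * hm
  rw [e1, e2, h0]
  clear e1 e2 h0 hp hm
  generalize hd1 : 1 - b*c*U^2 = d1 at *
  generalize hd2 : 1 - b*c*q*U^2 = d2 at *
  generalize hd3 : 1 - b*c*q^2*U^2 = d3 at *
  field_simp
  rw [← hd1, ← hd2, ← hd3]
  ring

-- level C+: left level M+1, W = q^M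
set_option maxHeartbeats 1000000 in
set_option maxRecDepth 100000 in
theorem algP (q a b c U V W Z N0 Np Nm : ℂ) (hq : q ≠ 0) (hU : U ≠ 0) (hV : V ≠ 0) (hW : W ≠ 0) (hc : c ≠ 0)
    (h1 : 1 - b*c*U^2 ≠ 0) (h2 : 1 - b*c*q*U^2 ≠ 0) (h3 : 1 - b*c*q^2*U^2 ≠ 0)
    (h0 : N0 = Z * (1 - V/U) * (1 - b*c*q*U*V))
    (hp : Np * (1 - b*c*q*U) = Z * (1 - 1/(U*q)) * (1 - b*c*q*U*V) * (1 - b*c*q^2*U*V))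
    (hm : Nm * (1 - 1/U) = Z * (1 - V/U) * (1 - q*V/U) * (1 - b*c*U)) :
    - Z * ((1 - V/(q*W)) * ((1-q*b*V)*(1-a*b*c*q^3*V*W)*(1-V/W)*(1-q*V)))
      + (1/(q*V) + a*b*q^2*V - 1/(c*W*q) - a*b*c*q^2*W) * N0 * (q*V) * (1-V/W)
    = q * V * (
       (-(U^2/W)*(1-W/U)*(1-q*W/U)*(1-b*q*U)*(1-b*c*q*U)*(1-a*b*c*q^3*V*W)*(-1/(q*W))/((1-b*c*q*U^2)*(1-b*c*q^2*U^2))) * (Np - N0)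
      + (-((1-U)*(1-c*U)*(1-b*c*q*U*W)*(1-b*c*q^2*U*W)*(1-a*b*c*q^3*V*W)*(-1/(q*W)))/(c*q*W*(1-b*c*U^2)*(1-b*c*q*U^2))) * (Nm - N0)
      + (-(1/(c*q*W)-1)) * (1-a*b*c*q^3*V*W) * (1-1/(q*W)) * N0) := by
  have e1 : (-(U^2/W)*(1-W/U)*(1-q*W/U)*(1-b*q*U)*(1-b*c*q*U)*(1-a*b*c*q^3*V*W)*(-1/(q*W))/((1-b*c*q*U^2)*(1-b*c*q^2*U^2))) * (Np - N0)
    = (-(U^2/W)*(1-W/U)*(1-q*W/U)*(1-b*q*U)*(1-a*b*c*q^3*V*W)*(-1/(q*W))/((1-b*c*q*U^2)*(1-b*c*q^2*U^2))) * (Z * (1 - b*c*q*U*V)) * ((1 - 1/(U*q)) * (1 - b*c*q^2*U*V) - (1-b*c*q*U) * (1 - V/U)) := by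
    rw [h0]; linear_combination (-(U^2/W)*(1-W/U)*(1-q*W/U)*(1-b*q*U)*(1-a*b*c*q^3*V*W)*(-1/(q*W))/((1-b*c*q*U^2)*(1-b*c*q^2*U^2))) * hp
  have e2 : (-((1-U)*(1-c*U)*(1-b*c*q*U*W)*(1-b*c*q^2*U*W)*(1-a*b*c*q^3*V*W)*(-1/(q*W)))/(c*q*W*(1-b*c*U^2)*(1-b*c*q*U^2))) * (Nm - N0)
    = (-((-U)*(1-c*U)*(1-b*c*q*U*W)*(1-b*c*q^2*U*W)*(1-a*b*c*q^3*V*W)*(-1/(q*W)))/(c*q*W*(1-b*c*U^2)*(1-b*c*q*U^2))) * (Z * (1 - V/U)) * ((1 - q*V/U) * (1 - b*c*U) - (1-1/U) * (1 - b*c*q*U*V)) := by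
    have : 1 - U = - U * (1 - 1/U) := by field_simp; ring
    rw [h0, this]; linear_combination (-((-U)*(1-c*U)*(1-b*c*q*U*W)*(1-b*c*q^2*U*W)*(1-a*b*c*q^3*V*W)*(-1/(q*W)))/(c*q*W*(1-b*c*U^2)*(1-b*c*q*U^2))) * hm
  rw [e1, e2, h0]
  clear e1 e2 h0 hp hm
  generalize hd1 : 1 - b*c*U^2 = d1 at *
  generalize hd2 : 1 - b*c*q*U^2 = d2 at *
  generalize hd3 : 1 - b*c*q^2*U^2 = d3 at *
  field_simp
  rw [← hd1, ← hd2, ← hd3]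
  ring

end qR

namespace qR

theorem poch_zero (q a : ℂ) : poch q a 0 = 1 := by simp [poch]
theorem poch_succ (q a : ℂ) (k : ℕ) : poch q a (k+1) = poch q a k * (1 - a*q^k) := by
  simp [poch, Finset.prod_range_succ]
theorem poch_succ_left (q a : ℂ) (k : ℕ) : poch q a (k+1) = (1 - a) * poch q (a*q) k := by
  simp only [poch, Finset.prod_range_succ']
  rw [mul_comm]; simp only [pow_zero, mul_one]
  congr 1
  refine Finset.prod_congr rfl fun l _ => ?_
  ring
theorem poch_shift (q a : ℂ) (k : ℕ) :
    (1 - a) * poch q (a*q) k = poch q a k * (1 - a*q^k) := by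
  rw [← poch_succ_left, poch_succ]
theorem poch_ne (q a : ℂ) (k : ℕ) (h : ∀ l < k, 1 - a*q^l ≠ 0) : poch q a k ≠ 0 := by
  unfold poch
  exact Finset.prod_ne_zero_iff.2 fun l hl => h l (Finset.mem_range.1 hl)
theorem poch_eq_zero (q a : ℂ) (k l : ℕ) (hl : l < k) (h : 1 - a*q^l = 0) : poch q a k = 0 :=
  Finset.prod_eq_zero (Finset.mem_range.2 hl) h

/-- genericity package -/
structure Good (q a b c : ℂ) (L : ℕ) : Prop where
  q0 : q ≠ 0
  a0 : a ≠ 0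
  b0 : b ≠ 0
  c0 : c ≠ 0
  h1 : ∀ k : ℕ, 1 ≤ k → k ≤ L → 1 - q^k ≠ 0
  ha : ∀ k : ℕ, k ≤ 2*L+5 → 1 - a*q^k ≠ 0
  hb : ∀ k : ℕ, k ≤ 2*L+5 → 1 - b*q^k ≠ 0
  hc : ∀ k : ℕ, k ≤ 2*L+5 → 1 - c*q^k ≠ 0
  hbc : ∀ k : ℕ, k ≤ 2*L+5 → 1 - b*c*q^k ≠ 0
  habc : ∀ k : ℕ, k ≤ 2*L+5 → 1 - a*b*c*q^k ≠ 0

def nu (q d : ℂ) (n k : ℕ) : ℂ := poch q (q^n)⁻¹ k * poch q (d*q^(n+1)) k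
def nuP (q d : ℂ) (n k : ℕ) : ℂ := if n = 0 then 0 else nu q d (n-1) k
def de (q a b c : ℂ) (M k : ℕ) : ℂ :=
  poch q (q*b) k * poch q (a*b*c*q^(M+2)) k * poch q (q^M)⁻¹ k * poch q q k
def ev (q f : ℂ) (x k : ℕ) : ℂ := poch q (q^x)⁻¹ k * poch q (f*q^(x+1)) k
def lamn (q f : ℂ) (x : ℕ) : ℂ := -(1 - (q^x)⁻¹) * (1 - f*q^(x+1))

theorem nu_succ (q d : ℂ) (n m : ℕ) :
    nu q d n (m+1) = nu q d n m * (1 - q^m/q^n) * (1 - d*q*q^n*q^m) := by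
  unfold nu; rw [poch_succ, poch_succ]; ring

theorem nu_up (q d : ℂ) (n m : ℕ) (hq : q ≠ 0) :
    nu q d (n+1) (m+1) * (1 - d*q*q^n)
      = nu q d n m * (1 - 1/(q^n*q)) * (1 - d*q*q^n*q^m) * (1 - d*q^2*q^n*q^m) := by
  unfold nu
  rw [poch_succ_left q (q^(n+1))⁻¹]
  have e1 : (q^(n+1))⁻¹*q = (q^n)⁻¹ := by field_simp; ring
  have e2 := poch_shift q (d*q^(n+1)) (m+1)
  rw [poch_succ q (d*q^(n+1))] at e2
  have e3 : d*q^(n+1)*q = d*q^(n+1+1) := by ring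
  rw [e3] at e2
  rw [e1]
  linear_combination ((1 - (q^(n+1))⁻¹) * poch q (q^n)⁻¹ m) * e2

theorem nu_dn (q d : ℂ) (n m : ℕ) (hq : q ≠ 0) :
    nuP q d n (m+1) * (1 - 1/q^n)
      = nu q d n m * (1 - q^m/q^n) * (1 - q*q^m/q^n) * (1 - d*q^n) := by
  unfold nuP
  rcases n with _ | n
  · have : nu q d 0 m * (1 - q^m/q^0) = 0 := by
      have h := poch_eq_zero q (q^0)⁻¹ (m+1) 0 (by omega) (by simp)
      rw [poch_succ] at h
      unfold nu
      linear_combination (poch q (d*q^(0+1)) m) * h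
    rw [this]; simp
  · simp only [Nat.add_eq_zero_iff, one_ne_zero, and_false, if_false, Nat.add_sub_cancel]
    unfold nu
    rw [poch_succ_left q (d*q^(n+1))]
    have e1 : (q^(n+1))⁻¹*q = (q^n)⁻¹ := by field_simp; ring
    have e2 := poch_shift q (q^(n+1))⁻¹ (m+1)
    rw [poch_succ q (q^(n+1))⁻¹, e1] at e2
    have e3 : d*q^(n+1)*q = d*q^(n+1+1) := by ring
    rw [e3]
    linear_combination ((1 - d*q^(n+1)) * poch q (d*q^(n+1+1)) m) * e2

theorem nu_zero (q d : ℂ) (n : ℕ) : nu q d n 0 = 1 := by simp [nu, poch_zero]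
theorem nu_big (q d : ℂ) (n k : ℕ) (hq : q ≠ 0) (h : n < k) : nu q d n k = 0 := by
  unfold nu; rw [poch_eq_zero q _ k n h (by field_simp; ring)]; ring
theorem ev_big (q d : ℂ) (n k : ℕ) (hq : q ≠ 0) (h : n < k) : ev q d n k = 0 := by
  unfold ev; rw [poch_eq_zero q _ k n h (by field_simp; ring)]; ring

theorem ev_mul (q f : ℂ) (x k : ℕ) (hq : q ≠ 0) :
    lamn q f x * ev q f x k = -(q^k)⁻¹ * ev q f x (k+1) + lamn q f k * ev q f x k := by
  unfold ev lamn; rw [poch_succ, poch_succ]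
  have := pow_ne_zero k hq
  have := pow_ne_zero x hq
  field_simp
  ring

theorem tele (q f μ : ℂ) (x K : ℕ) (α β : ℕ → ℂ) (hq : q ≠ 0) (h0 : β 0 = -μ * α 0)
    (hs : ∀ m < K, β (m+1) = -(q^m)⁻¹ * α m + (lamn q f (m+1) - μ) * α (m+1)) :
    (lamn q f x - μ) * ∑ k ∈ Finset.range (K+1), α k * ev q f x k
      = ∑ k ∈ Finset.range (K+1), β k * ev q f x k - (q^K)⁻¹ * α K * ev q f x (K+1) := by
  induction K with
  | zero =>
    have := ev_mul q f x 0 hq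
    have h : lamn q f 0 = 0 := by simp [lamn]
    rw [h] at this
    simp only [zero_add, Finset.sum_range_one, h0]
    linear_combination α 0 * this
  | succ K ih =>
    rw [Finset.sum_range_succ, mul_add, ih (fun m hm => hs m (by omega)),
      Finset.sum_range_succ _ (K+1), hs K (by omega)]
    have := ev_mul q f x (K+1) hq
    linear_combination α (K+1) * this

end qR

namespace qR

def Rr (q a b c : ℂ) (M n x : ℕ) : ℂ :=
  ∑ k ∈ Finset.range (M+1), nu q (b*c) n k * q^k / de q a b c M k * ev q (a*b) x k
def RrP (q a b c : ℂ) (M n x : ℕ) : ℂ :=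
  ∑ k ∈ Finset.range (M+1), nuP q (b*c) n k * q^k / de q a b c M k * ev q (a*b) x k

theorem RrP_succ (q a b c : ℂ) (M n x : ℕ) : RrP q a b c M (n+1) x = Rr q a b c M n x := by
  simp [RrP, Rr, nuP]

def BR (q a b c U W : ℂ) : ℂ :=
  (1 - U/W)*(1-a*b*c*q^2*U*W)*(1-b*q*U)*(1-b*c*q*U)/((1-b*c*q*U^2)*(1-b*c*q^2*U^2))
def DR (q a b c U W : ℂ) : ℂ :=
  -b*U/W*(1-U)*(1-a*q*W/U)*(1-b*c*q*U*W)*(1-c*U)/((1-b*c*U^2)*(1-b*c*q*U^2))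
def gP (q a b c U W : ℂ) : ℂ :=
  -(U^2/W)*(1-W/U)*(1-q*W/U)*(1-b*q*U)*(1-b*c*q*U)*(1-a*b*c*q^2*W)
    /((1-b*c*q*U^2)*(1-b*c*q^2*U^2)*(1-q*W))
def gM (q a b c U W : ℂ) : ℂ :=
  -((1-U)*(1-c*U)*(1-b*c*q*U*W)*(1-b*c*q^2*U*W)*(1-a*b*c*q^2*W))
    /(c*q*W*(1-b*c*U^2)*(1-b*c*q*U^2)*(1-q*W))
def hP (q a b c U W : ℂ) : ℂ :=
  -((1-b*q*U)*(1-b*c*q*U)*(1-a*b*c*q*U*W)*(1-a*b*c*q^2*U*W)*(1-W))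
    /(W*(1-b*c*q*U^2)*(1-b*c*q^2*U^2)*(1-a*b*c*q*W))
def hM (q a b c U W : ℂ) : ℂ :=
  -c*(q*b)^2*U^2/(W*q)*(1-U)*(1-c*U)*(1-a*q*W/U)*(1-a*W/U)*(1-W)
    /((1-b*c*U^2)*(1-b*c*q*U^2)*(1-a*b*c*q*W))
def muP (q a b c W : ℂ) : ℂ := 1/(c*q*W) + a*b*c*q^2*W - 1 - a*b*q

/-- generic summation step -/
theorem sumstep (q a b c μ P D : ℂ) (M n x : ℕ) (α : ℕ → ℂ) (hq : q ≠ 0)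
    (hD : n = 0 → D = 0) (hα : α 0 = 1)
    (hlast : α M * ev q (a*b) x (M+1) = 0)
    (hs : ∀ m < M, (P * (nu q (b*c) (n+1) (m+1) - nu q (b*c) n (m+1))
        + D * (nuP q (b*c) n (m+1) - nu q (b*c) n (m+1)) - μ * nu q (b*c) n (m+1))
          * q^(m+1) / de q a b c M (m+1)
      = -(q^m)⁻¹ * α m + (lamn q (a*b) (m+1) - μ) * α (m+1)) :
    (lamn q (a*b) x - μ) * ∑ k ∈ Finset.range (M+1), α k * ev q (a*b) x k
      = P * Rr q a b c M (n+1) x + (-μ - P - D) * Rr q a b c M n x + D * RrP q a b c M n x := by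
  rw [tele q (a*b) μ x M α (fun k => (P * (nu q (b*c) (n+1) k - nu q (b*c) n k)
        + D * (nuP q (b*c) n k - nu q (b*c) n k) - μ * nu q (b*c) n k)
          * q^k / de q a b c M k) hq ?_ (fun m hm => hs m hm)]
  · have : (q^M)⁻¹ * α M * ev q (a*b) x (M+1) = 0 := by rw [mul_assoc, hlast, mul_zero]
    rw [this, sub_zero]
    unfold Rr RrP
    rw [Finset.mul_sum, Finset.mul_sum, Finset.mul_sum, ← Finset.sum_add_distrib,
      ← Finset.sum_add_distrib]
    refine Finset.sum_congr rfl fun k _ => ?_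
    ring
  · have hd : de q a b c M 0 = 1 := by simp [de, poch_zero]
    simp only [nu_zero, hd, hα, nuP]
    by_cases hn : n = 0
    · simp [hn, hD hn]
    · simp [hn]

theorem auxR (q V Y F Z N0 X lam : ℂ) (hV : V ≠ 0) (hY : Y ≠ 0) (hF : F ≠ 0)
    (E : -Z*F + lam*(N0*(q*V)) = q*V*X) :
    X*(V*q)/(Y*F) = -V⁻¹*(Z*V/Y) + (lam - 0)*(N0*(V*q)/(Y*F)) := by
  field_simp
  linear_combination -E

theorem powW (q : ℂ) (M k : ℕ) (hq : q ≠ 0) (hk : k < M)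
    (h1 : ∀ k : ℕ, 1 ≤ k → k ≤ M → 1 - q^k ≠ 0) : 1 - q^k/q^M ≠ 0 := by
  have h := h1 (M-k) (by omega) (by omega)
  have e : q^M = q^(M-k) * q^k := by rw [← pow_add]; congr 1; omega
  have h2 := pow_ne_zero k hq
  have h3 := pow_ne_zero (M-k) hq
  rw [e]
  intro h0
  apply h
  field_simp at h0
  linear_combination -h0

theorem de_ne {q a b c : ℂ} {L : ℕ} (g : Good q a b c L) (M k : ℕ) (hM : M ≤ L) (hk : k ≤ M) :
    de q a b c M k ≠ 0 := by
  unfold de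
  refine mul_ne_zero (mul_ne_zero (mul_ne_zero ?_ ?_) ?_) ?_ <;> refine poch_ne _ _ _ fun l hl => ?_
  · have := g.hb (l+1) (by omega)
    rwa [show q*b*q^l = b*q^(l+1) by ring]
  · have := g.habc (M+2+l) (by omega)
    rwa [show a*b*c*q^(M+2)*q^l = a*b*c*q^(M+2+l) by ring]
  · have := powW q M l g.q0 (by omega) (fun k hk hk' => g.h1 k hk (by omega))
    rwa [show (q^M)⁻¹*q^l = q^l/q^M by ring]
  · have := g.h1 (l+1) (by omega) (by omega)
    rwa [show q*q^l = q^(l+1) by ring]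

theorem dens {q a b c : ℂ} {L : ℕ} (g : Good q a b c L) (n : ℕ) (hn : n ≤ L+1) :
    1 - b*c*(q^n)^2 ≠ 0 ∧ 1 - b*c*q*(q^n)^2 ≠ 0 ∧ 1 - b*c*q^2*(q^n)^2 ≠ 0 := by
  refine ⟨?_, ?_, ?_⟩
  · have := g.hbc (2*n) (by omega)
    rwa [show b*c*(q^n)^2 = b*c*q^(2*n) by ring]
  · have := g.hbc (2*n+1) (by omega)
    rwa [show b*c*q*(q^n)^2 = b*c*q^(2*n+1) by ring]
  · have := g.hbc (2*n+2) (by omega)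
    rwa [show b*c*q^2*(q^n)^2 = b*c*q^(2*n+2) by ring]

theorem de_succ (q a b c : ℂ) (M m : ℕ) : de q a b c M (m+1) = de q a b c M m *
    ((1 - q*b*q^m) * (1 - a*b*c*q^2*q^M*q^m) * (1 - q^m/q^M) * (1 - q*q^m)) := by
  unfold de; rw [poch_succ, poch_succ, poch_succ, poch_succ]; ring

theorem recR {q a b c : ℂ} {L : ℕ} (g : Good q a b c L) (M n x : ℕ) (hM : M ≤ L) (hn : n ≤ M)
    (hx : x ≤ M) :
    lamn q (a*b) x * Rr q a b c M n x
      = BR q a b c (q^n) (q^M) * Rr q a b c M (n+1) x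
        + (- BR q a b c (q^n) (q^M) - DR q a b c (q^n) (q^M)) * Rr q a b c M n x
        + DR q a b c (q^n) (q^M) * RrP q a b c M n x := by
  have hq := g.q0
  have key := sumstep q a b c 0 (BR q a b c (q^n) (q^M)) (DR q a b c (q^n) (q^M)) M n x
    (fun k => nu q (b*c) n k * q^k / de q a b c M k) hq (by rintro rfl; simp [DR])
    (by simp [nu_zero, de, poch_zero]) (by rw [ev_big q _ x _ hq (by omega), mul_zero]) ?_
  · rw [sub_zero] at key
    rw [Rr, key]; simp only [Rr]; ring
  · intro m hm
    obtain ⟨d1, d2, d3⟩ := dens g n (by omega)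
    have E := algR q a b c (q^n) (q^m) (q^M) (nu q (b*c) n m) _ _ _ hq (pow_ne_zero _ hq)
      (pow_ne_zero _ hq) (pow_ne_zero _ hq) d1 d2 d3 (nu_succ q (b*c) n m)
      (nu_up q (b*c) n m hq) (nu_dn q (b*c) n m hq)
    have hne := de_ne g M (m+1) hM (by omega)
    rw [de_succ] at hne ⊢
    have A := auxR q (q^m) (de q a b c M m) _ (nu q (b*c) n m) (nu q (b*c) n (m+1))
      (BR q a b c (q^n) (q^M) * (nu q (b*c) (n+1) (m+1) - nu q (b*c) n (m+1))
        + DR q a b c (q^n) (q^M) * (nuP q (b*c) n (m+1) - nu q (b*c) n (m+1)))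
      (lamn q (a*b) (m+1)) (pow_ne_zero _ hq) (left_ne_zero_of_mul hne) (right_ne_zero_of_mul hne) ?_
    · rw [pow_succ, zero_mul, sub_zero]
      exact A
    · unfold BR DR lamn
      rw [← E]
      ring

end qR

namespace qR

theorem auxM (q V Y d0 d1 F G H I J Z N0 X T T' dm dm1 : ℂ) (hV : V ≠ 0) (hq : q ≠ 0)
    (hY : Y ≠ 0) (hd0 : d0 ≠ 0) (hd1 : d1 ≠ 0) (hF : F ≠ 0) (hG : G ≠ 0) (hH : H ≠ 0) (hI : I ≠ 0)
    (hJ : J ≠ 0 ∨ N0 = 0) (hdm : dm = Y*d0/d1) (hdm1 : dm1 = Y*d0*F*J*I)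
    (hT : T' * (q*V) = T * J)
    (E : -Z*(d1*F*G*H*I) + T*N0*(G*H) = q*V*(d0*X)) :
    X*(V*q)/(Y*F*G*H*I) = -V⁻¹*(Z*V/dm) + T'*(N0*(V*q)/dm1) := by
  have e1 : T'*(N0*(V*q)/dm1) = T*N0/(Y*d0*F*I) := by
    rcases hJ with h | h
    · have : T'*(N0*(V*q)/dm1) = (T' * (q*V))*N0/dm1 := by ring
      rw [this, hT, hdm1]; field_simp
    · simp [h]
  rw [e1, hdm]
  field_simp
  linear_combination -E

theorem auxP (q V Y d0 d1 F G G0 I J Z N0 X T' dm dm1 : ℂ) (hV : V ≠ 0)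
    (hY : Y ≠ 0) (hd0 : d0 ≠ 0) (hd1 : d1 ≠ 0) (hF : F ≠ 0) (hG : G ≠ 0) (hG0 : G0 ≠ 0) (hI : I ≠ 0)
    (hJ : J ≠ 0) (hdm : dm = Y*d0/d1) (hdm1 : dm1 = Y*F*G*d0*I)
    (E : -Z*(d1*(F*G*J*I)) + T'*N0*(q*V)*J = q*V*(X*G*d0/G0)) :
    X*(V*q)/(Y*F*G0*J*I) = -V⁻¹*(Z*V/dm) + T'*(N0*(V*q)/dm1) := by
  rw [hdm, hdm1]
  field_simp
  field_simp at E
  linear_combination -E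

theorem recM {q a b c : ℂ} {L : ℕ} (g : Good q a b c L) (l n x : ℕ) (hL : l+1 ≤ L) (hn : n ≤ l) :
    (lamn q (a*b) x - lamn q (a*b) (l+1)) * Rr q a b c l n x
      = hP q a b c (q^n) (q^(l+1)) * Rr q a b c (l+1) (n+1) x
        + (- lamn q (a*b) (l+1) - hP q a b c (q^n) (q^(l+1)) - hM q a b c (q^n) (q^(l+1)))
            * Rr q a b c (l+1) n x
        + hM q a b c (q^n) (q^(l+1)) * RrP q a b c (l+1) n x := by
  have hq := g.q0
  rw [← sumstep q a b c (lamn q (a*b) (l+1)) (hP q a b c (q^n) (q^(l+1))) (hM q a b c (q^n) (q^(l+1)))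
    (l+1) n x (fun k => nu q (b*c) n k * q^k / de q a b c l k) hq (by rintro rfl; simp [qR.hM])
    (by simp [nu_zero, de, poch_zero]) (by simp [nu_big q _ n (l+1) hq (by omega)]) ?_]
  · rw [Finset.sum_range_succ, nu_big q _ n (l+1) hq (by omega), Rr]; simp
  · intro m hm
    obtain ⟨d1, d2, d3⟩ := dens g n (by omega)
    have hVV := pow_ne_zero m hq
    have hWW := pow_ne_zero (l+1) hq
    have E := algM q a b c (q^n) (q^m) (q^(l+1)) (nu q (b*c) n m) _ _ _ hq (pow_ne_zero _ hq)
      hVV hWW d1 d2 d3 (nu_succ q (b*c) n m)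
      (nu_up q (b*c) n m hq) (nu_dn q (b*c) n m hq)
    have hne := de_ne g (l+1) (m+1) hL (by omega)
    have hc0 : 1 - a*b*c*q*q^(l+1) ≠ 0 := by
      have := g.habc (l+2) (by omega)
      rwa [show a*b*c*q*q^(l+1) = a*b*c*q^(l+2) by ring]
    have hc1 : 1 - a*b*c*q*q^m*q^(l+1) ≠ 0 := by
      have := g.habc (l+2+m) (by omega)
      rwa [show a*b*c*q*q^m*q^(l+1) = a*b*c*q^(l+2+m) by ring]
    have eq1 : (q^(l+1))⁻¹*q = (q^l)⁻¹ := by field_simp; ring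
    have sh : (1 - a*b*c*q^(l+2)) * poch q (a*b*c*q^(l+1+2)) m
        = poch q (a*b*c*q^(l+2)) m * (1 - a*b*c*q^(l+2)*q^m) := by
      rw [← poch_shift]; congr 2; ring
    set Y := poch q (q*b) m * poch q (a*b*c*q^(l+1+2)) m * poch q (q^l)⁻¹ m * poch q q m with hY
    have D1 : de q a b c (l+1) (m+1) = Y * (1-q*b*q^m) * (1-a*b*c*q^2*q^m*q^(l+1)) * (1-1/q^(l+1)) * (1-q*q^m) := by
      rw [hY]; unfold de
      rw [poch_succ q (q*b), poch_succ q (a*b*c*q^(l+1+2)), poch_succ q q, poch_succ_left q (q^(l+1))⁻¹, eq1]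
      ring
    have D2 : de q a b c l m = Y * (1 - a*b*c*q*q^(l+1)) / (1 - a*b*c*q*q^m*q^(l+1)) := by
      rw [eq_div_iff hc1, hY]; unfold de
      linear_combination -(poch q (q*b) m * poch q (q^l)⁻¹ m * poch q q m) * sh
    have D3 : de q a b c l (m+1) = Y * (1 - a*b*c*q*q^(l+1)) * (1-q*b*q^m) * (1 - q*q^m/q^(l+1)) * (1-q*q^m) := by
      rw [hY]; unfold de
      rw [poch_succ q (q*b), poch_succ q q, poch_succ_left q (a*b*c*q^(l+2)), poch_succ q (q^l)⁻¹, ← eq1]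
      rw [show a*b*c*q^(l+2)*q = a*b*c*q^(l+1+2) by ring]
      ring
    rw [D1] at hne ⊢
    have n5 := right_ne_zero_of_mul hne
    have hne := left_ne_zero_of_mul hne
    have n4 := right_ne_zero_of_mul hne
    have hne := left_ne_zero_of_mul hne
    have n3 := right_ne_zero_of_mul hne
    have hne := left_ne_zero_of_mul hne
    have n2 := right_ne_zero_of_mul hne
    have n1 := left_ne_zero_of_mul hne
    rw [pow_succ q m]
    refine auxM q (q^m) Y (1 - a*b*c*q*q^(l+1)) (1 - a*b*c*q*q^m*q^(l+1)) _ _ _ _ (1 - q*q^m/q^(l+1))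
      (nu q (b*c) n m) (nu q (b*c) n (m+1)) _ (1 - a*b*q^2*q^m*q^(l+1)) _ _ _
      hVV hq n1 hc0 hc1 n2 n3 n4 n5 ?_ D2 D3 ?_ ?_
    · by_cases h : m = l
      · right; exact nu_big _ _ _ _ hq (by omega)
      · left
        have := powW q (l+1) (m+1) hq (by omega) (fun k hk hk' => g.h1 k hk (by omega))
        rwa [show q*q^m = q^(m+1) by ring]
    · unfold lamn
      rw [show q^(m+1+1) = q^m*q^2 by ring, show q^(l+1+1) = q^(l+1)*q by ring, show q^(m+1) = q^m*q by ring]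
      field_simp
      ring
    · rw [E]
      have x1 : hP q a b c (q^n) (q^(l+1)) * (1-a*b*c*q*q^(l+1)) = (-((1-b*q*q^n)*(1-b*c*q*q^n)*(1-a*b*c*q*q^n*q^(l+1))*(1-a*b*c*q^2*q^n*q^(l+1))*(1-q^(l+1)))/(q^(l+1)*(1-b*c*q*(q^n)^2)*(1-b*c*q^2*(q^n)^2))) := by
        unfold hP; rw [div_mul_eq_mul_div, mul_div_mul_right _ _ hc0]
      have x2 : hM q a b c (q^n) (q^(l+1)) * (1-a*b*c*q*q^(l+1)) = -c*(q*b)^2*(q^n)^2/(q^(l+1)*q)*(1-q^n)*(1-c*q^n)*(1-a*q*q^(l+1)/q^n)*(1-a*q^(l+1)/q^n)*(1-q^(l+1))/((1-b*c*(q^n)^2)*(1-b*c*q*(q^n)^2)) := by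
        unfold qR.hM; rw [div_mul_eq_mul_div, mul_div_mul_right _ _ hc0]
      have x3 : - lamn q (a*b) (l+1) = -(1/q^(l+1)-1)*(1-a*b*q*q^(l+1)) := by
        unfold lamn; ring
      rw [← x1, ← x2, ← x3]
      ring

theorem recP {q a b c : ℂ} {L : ℕ} (g : Good q a b c L) (M n x : ℕ) (hM : M+1 ≤ L) (hn : n ≤ M+1)
    (hx : x ≤ M) :
    (lamn q (a*b) x - muP q a b c (q^M)) * Rr q a b c (M+1) n x
      = gP q a b c (q^n) (q^M) * Rr q a b c M (n+1) x
        + (- muP q a b c (q^M) - gP q a b c (q^n) (q^M) - gM q a b c (q^n) (q^M))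
            * Rr q a b c M n x
        + gM q a b c (q^n) (q^M) * RrP q a b c M n x := by
  have hq := g.q0
  have hcc := g.c0
  rw [← sumstep q a b c (muP q a b c (q^M)) (gP q a b c (q^n) (q^M)) (gM q a b c (q^n) (q^M))
    M n x (fun k => nu q (b*c) n k * q^k / de q a b c (M+1) k) hq (by rintro rfl; simp [gM])
    (by simp [nu_zero, de, poch_zero]) (by rw [ev_big q _ x _ hq (by omega), mul_zero]) ?_]
  · rw [Rr, Finset.sum_range_succ, ev_big q _ x (M+1) hq (by omega)]; simp
  · intro m hm
    obtain ⟨d1, d2, d3⟩ := dens g n (by omega)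
    have hVV := pow_ne_zero m hq
    have hWW := pow_ne_zero M hq
    have E := algP q a b c (q^n) (q^m) (q^M) (nu q (b*c) n m) _ _ _ hq (pow_ne_zero _ hq)
      hVV hWW hcc d1 d2 d3 (nu_succ q (b*c) n m)
      (nu_up q (b*c) n m hq) (nu_dn q (b*c) n m hq)
    have hne := de_ne g M (m+1) (by omega) (by omega)
    have hc0 : 1 - 1/(q*q^M) ≠ 0 := by
      have := powW q (M+1) 0 hq (by omega) (fun k hk hk' => g.h1 k hk (by omega))
      rwa [show q*q^M = q^(M+1) by ring, ← pow_zero q]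
    have hc1 : 1 - q^m/(q*q^M) ≠ 0 := by
      have := powW q (M+1) m hq (by omega) (fun k hk hk' => g.h1 k hk (by omega))
      rwa [show q*q^M = q^(M+1) by ring]
    have hG : 1 - a*b*c*q^3*q^m*q^M ≠ 0 := by
      have := g.habc (M+3+m) (by omega)
      rwa [show a*b*c*q^3*q^m*q^M = a*b*c*q^(M+3+m) by ring]
    have eq1 : (q^(M+1))⁻¹*q = (q^M)⁻¹ := by field_simp; ring
    have sh : (1 - (q^(M+1))⁻¹) * poch q (q^M)⁻¹ m
        = poch q (q^(M+1))⁻¹ m * (1 - (q^(M+1))⁻¹*q^m) := by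
      rw [← poch_shift, eq1]
    set Y := poch q (q*b) m * poch q (a*b*c*q^(M+1+2)) m * poch q (q^M)⁻¹ m * poch q q m with hY
    have D1 : de q a b c M (m+1) = Y * (1-q*b*q^m) * (1-a*b*c*q^2*q^M) * (1-q^m/q^M) * (1-q*q^m) := by
      rw [hY]; unfold de
      rw [poch_succ q (q*b), poch_succ_left q (a*b*c*q^(M+2)), poch_succ q q, poch_succ q (q^M)⁻¹]
      rw [show a*b*c*q^(M+2)*q = a*b*c*q^(M+1+2) by ring]
      ring
    have D2 : de q a b c (M+1) m = Y * (1 - 1/(q*q^M)) / (1 - q^m/(q*q^M)) := by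
      rw [eq_div_iff hc1, hY]; unfold de
      rw [show q*q^M = q^(M+1) by ring]
      linear_combination -(poch q (q*b) m * poch q (a*b*c*q^(M+1+2)) m * poch q q m) * sh
    have D3 : de q a b c (M+1) (m+1) = Y * (1-q*b*q^m) * (1 - a*b*c*q^3*q^m*q^M) * (1 - 1/(q*q^M)) * (1-q*q^m) := by
      rw [hY]; unfold de
      rw [poch_succ q (q*b), poch_succ q q, poch_succ q (a*b*c*q^(M+1+2)), poch_succ_left q (q^(M+1))⁻¹, eq1]
      rw [show q*q^M = q^(M+1) by ring]
      ring
    rw [D1] at hne ⊢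
    have n5 := right_ne_zero_of_mul hne
    have hne := left_ne_zero_of_mul hne
    have n4 := right_ne_zero_of_mul hne
    have hne := left_ne_zero_of_mul hne
    have n3 := right_ne_zero_of_mul hne
    have hne := left_ne_zero_of_mul hne
    have n2 := right_ne_zero_of_mul hne
    have n1 := left_ne_zero_of_mul hne
    rw [pow_succ q m]
    refine auxP q (q^m) Y (1 - 1/(q*q^M)) (1 - q^m/(q*q^M)) _ (1 - a*b*c*q^3*q^m*q^M) _ _ _
      (nu q (b*c) n m) (nu q (b*c) n (m+1)) _ _ _ _
      hVV n1 hc0 hc1 n2 hG n3 n5 n4 D2 D3 ?_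
    have hT : lamn q (a*b) (m+1) - muP q a b c (q^M)
        = 1/(q*q^m) + a*b*q^2*q^m - 1/(c*q^M*q) - a*b*c*q^2*q^M := by
      unfold lamn muP
      rw [show q^(m+1+1) = q^m*q^2 by ring, show q^(m+1) = q^m*q by ring]
      field_simp
      ring
    rw [hT, E]
    have hqW : 1 - q*q^M = -(q*q^M) * (1 - 1/(q*q^M)) := by field_simp; ring
    have x1 : gP q a b c (q^n) (q^M) * (1-1/(q*q^M)) / (1-a*b*c*q^2*q^M) = (-((q^n)^2/q^M)*(1-q^M/q^n)*(1-q*q^M/q^n)*(1-b*q*q^n)*(1-b*c*q*q^n)*(-1/(q*q^M))/((1-b*c*q*(q^n)^2)*(1-b*c*q^2*(q^n)^2))) := by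
      unfold gP; rw [hqW]
      generalize 1 - 1/(q*q^M) = z at *
      generalize 1-a*b*c*q^2*q^M = z2 at *
      generalize 1-b*c*q*(q^n)^2 = z3 at *
      generalize 1-b*c*q^2*(q^n)^2 = z4 at *
      generalize 1-q^M/q^n = z5 at *
      generalize 1-q*q^M/q^n = z6 at *
      field_simp
    have x2 : gM q a b c (q^n) (q^M) * (1-1/(q*q^M)) / (1-a*b*c*q^2*q^M) = (-((1-q^n)*(1-c*q^n)*(1-b*c*q*q^n*q^M)*(1-b*c*q^2*q^n*q^M)*(-1/(q*q^M)))/(c*q*q^M*(1-b*c*(q^n)^2)*(1-b*c*q*(q^n)^2))) := by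
      unfold gM; rw [hqW]
      generalize 1 - 1/(q*q^M) = z at *
      generalize 1-a*b*c*q^2*q^M = z2 at *
      generalize 1-b*c*q*(q^n)^2 = z3 at *
      generalize 1-b*c*(q^n)^2 = z4 at *
      field_simp
    have x3 : - muP q a b c (q^M) / (1-a*b*c*q^2*q^M) = -(1/(c*q*q^M)-1) := by
      rw [div_eq_iff n3]; unfold muP; field_simp; ring
    rw [show (-(1/(c*q*q^M)-1)) * (1-a*b*c*q^3*q^m*q^M) * (1-1/(q*q^M)) * nu q (b*c) n (m+1) = (- muP q a b c (q^M) / (1-a*b*c*q^2*q^M)) * (1-a*b*c*q^3*q^m*q^M) * (1-1/(q*q^M)) * nu q (b*c) n (m+1) by rw [x3]]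
    rw [show ∀ X : ℂ, X * (1-a*b*c*q^3*q^m*q^M) * (1 - 1/(q*q^M)) / (1-a*b*c*q^2*q^M) = (X * (1 - 1/(q*q^M)) / (1-a*b*c*q^2*q^M)) * (1-a*b*c*q^3*q^m*q^M) by intro X; ring]
    linear_combination (-(1-a*b*c*q^3*q^m*q^M) * q * q^m) * ((nu q (b*c) (n+1) (m+1) - nu q (b*c) n (m+1)) * x1 + (nuP q (b*c) n (m+1) - nu q (b*c) n (m+1)) * x2)

end qR

namespace qR

def Omn (q v a b c : ℂ) (M n : ℕ) : ℂ :=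
  if n ≤ M then poch q q M / (poch q q n * poch q q (M-n)) * (1 - b*c*q^(2*n+1)) * poch q (q*b) n
      * poch q (a*b*c*q^(M+2)) n * poch q (q*a) (M-n)
    / (v^(2*(n:ℤ)-M) * poch q (b*c*q^(n+1)) (M+1) * poch q (q*c) n) else 0

theorem auxr (QM Qn Qd x1 x2 x3 x4 x5 x6 y1 y2 t1 t3 Bn Cn Ad vz w P G : ℂ)
    (h1 : x1 ≠ 0) (h4 : x4 ≠ 0) (h5 : x5 ≠ 0) (h6 : x6 ≠ 0) (h7 : y1 ≠ 0) (hw : w ≠ 0) :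
    (QM/(Qn*x1*Qd)*t3*(Bn*x2)*(Cn*x3)*Ad/((vz*w)*(P*x4/x5)*(G*x6))) * (x1*t1*y2*w*x4*x6)
     = (QM/(Qn*(Qd*y1))*t1*Bn*Cn*(Ad*y2)/(vz*P*G)) * (y1*t3*x2*x3*x5) := by
  have e1 := mul_inv_cancel₀ h1
  have e4 := mul_inv_cancel₀ h4
  have e6 := mul_inv_cancel₀ h6
  have e7 := mul_inv_cancel₀ h7
  have ew := mul_inv_cancel₀ hw
  simp only [div_eq_mul_inv, mul_inv, inv_inv]
  trans (QM*Qn⁻¹*Qd⁻¹*t3*Bn*x2*Cn*x3*Ad*vz⁻¹*P⁻¹*x5*G⁻¹*t1*y2)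
  · trans (QM*Qn⁻¹*Qd⁻¹*t3*Bn*x2*Cn*x3*Ad*vz⁻¹*P⁻¹*x5*G⁻¹*t1*y2)*((x1*x1⁻¹)*(w*w⁻¹)*(x4*x4⁻¹)*(x6*x6⁻¹))
    · generalize x1⁻¹ = x1i, w⁻¹ = wi, x4⁻¹ = x4i, x6⁻¹ = x6i, Qn⁻¹ = Qi, Qd⁻¹ = Qdi, vz⁻¹ = vi, P⁻¹ = Pi, G⁻¹ = Gi
      ring
    · rw [e1, e4, e6, ew]; ring
  · symm
    trans (QM*Qn⁻¹*Qd⁻¹*t3*Bn*x2*Cn*x3*Ad*vz⁻¹*P⁻¹*x5*G⁻¹*t1*y2)*(y1*y1⁻¹)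
    · generalize y1⁻¹ = x1i, Qn⁻¹ = Qi, Qd⁻¹ = Qdi, vz⁻¹ = vi, P⁻¹ = Pi, G⁻¹ = Gi
      ring
    · rw [e7]; ring

theorem Omn_r {q v a b c : ℂ} {L : ℕ} (g : Good q a b c L) (hv : v^2 = q*b) (M n : ℕ) (hM : M ≤ L) :
    Omn q v a b c M (n+1) * ((1-q*q^n)*(1-b*c*q*(q^n)^2)*(1-a*q^M/q^n)*(q*b)*(1-b*c*q^2*q^n*q^M)*(1-c*q*q^n))
     = Omn q v a b c M n * ((1-q^M/q^n)*(1-b*c*q^3*(q^n)^2)*(1-b*q*q^n)*(1-a*b*c*q^2*q^n*q^M)*(1-b*c*q*q^n)) := by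
  have hq := g.q0
  have hv0 : v ≠ 0 := by
    rintro rfl
    have := mul_ne_zero hq g.b0
    apply this; rw [← hv]; simp
  rcases lt_trichotomy n M with h | h | h
  · obtain ⟨d, rfl⟩ : ∃ d, M = n + d + 1 := ⟨M-n-1, by omega⟩
    unfold Omn
    rw [if_pos (by omega), if_pos (by omega)]
    rw [show n+d+1-(n+1) = d by omega, show n+d+1-n = d+1 by omega]
    have hz : v^(2*((n+1:ℕ):ℤ)-((n+d+1:ℕ):ℤ)) = v^(2*(n:ℤ)-((n+d+1:ℕ):ℤ)) * (q*b) := by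
      rw [← hv, ← zpow_natCast v 2, ← zpow_add₀ hv0]; congr 1; push_cast; ring
    have e5 : 1 - b*c*q^(n+1) ≠ 0 := g.hbc _ (by omega)
    have sh : poch q (b*c*q^(n+1+1)) (n+d+1+1) = poch q (b*c*q^(n+1)) (n+d+1+1) * (1 - b*c*q^(n+1)*q^(n+d+1+1)) / (1 - b*c*q^(n+1)) := by
      rw [eq_div_iff e5, ← poch_shift, mul_comm]; congr 2; ring
    rw [sh, hz, poch_succ q q n, poch_succ q (q*b) n, poch_succ q (q*c) n, poch_succ q (a*b*c*q^(n+d+1+2)) n,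
      poch_succ q q d, poch_succ q (q*a) d]
    have := auxr (poch q q (n+d+1)) (poch q q n) (poch q q d) (1 - q*q^n) (1-q*b*q^n) (1 - a*b*c*q^(n+d+1+2)*q^n)
      (1 - b*c*q^(n+1)*q^(n+d+1+1)) (1 - b*c*q^(n+1)) (1-q*c*q^n) (1 - q*q^d) (1-q*a*q^d) (1-b*c*q^(2*n+1)) (1-b*c*q^(2*(n+1)+1))
      (poch q (q*b) n) (poch q (a*b*c*q^(n+d+1+2)) n) (poch q (q*a) d) (v^(2*(n:ℤ)-((n+d+1:ℕ):ℤ))) (q*b)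
      (poch q (b*c*q^(n+1)) (n+d+1+1)) (poch q (q*c) n)
      (by have := g.h1 (n+1) (by omega) (by omega); rwa [show q*q^n = q^(n+1) by ring])
      (by have := g.hbc (n+1+(n+d+1+1)) (by omega); rwa [show b*c*q^(n+1)*q^(n+d+1+1) = b*c*q^(n+1+(n+d+1+1)) by ring])
      e5
      (by have := g.hc (n+1) (by omega); rwa [show q*c*q^n = c*q^(n+1) by ring])
      (by have := g.h1 (d+1) (by omega) (by omega); rwa [show q*q^d = q^(d+1) by ring])
      (mul_ne_zero hq g.b0)
    have hU := pow_ne_zero n hq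
    have e1 : q^(n+d+1)/q^n = q*q^d := by field_simp; ring
    have e2 : a*q^(n+d+1)/q^n = q*a*q^d := by rw [mul_div_assoc, e1]; ring
    rw [e1, e2]
    convert this using 2 <;> ring
  · subst h
    have : Omn q v a b c n (n+1) = 0 := by simp [Omn]
    rw [this, div_self (pow_ne_zero n hq)]; ring
  · have h1 : Omn q v a b c M (n+1) = 0 := by unfold Omn; rw [if_neg (by omega)]
    have h2 : Omn q v a b c M n = 0 := by unfold Omn; rw [if_neg (by omega)]
    rw [h1, h2]; ring

theorem auxu (QM Qn Qd x1 x2 x3 x4 y1 y2 t1 Bn Cn Ad vz w P G : ℂ)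
    (h1 : x1 ≠ 0) (h3 : x3 ≠ 0) (h4 : x4 ≠ 0) (hw : w ≠ 0) :
    (QM/(Qn*Qd)*t1*Bn*Cn*Ad/(vz*w*P*G)) * (y1*x2*y2*w)
     = (QM*y1/(Qn*(Qd*x1))*t1*Bn*(Cn*x2/x3)*(Ad*y2)/(vz*(P*x4)*G)) * (x1*x3*x4) := by
  have e1 := mul_inv_cancel₀ h1
  have e3 := mul_inv_cancel₀ h3
  have e4 := mul_inv_cancel₀ h4
  have ew := mul_inv_cancel₀ hw
  simp only [div_eq_mul_inv, mul_inv, inv_inv]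
  trans (QM*Qn⁻¹*Qd⁻¹*t1*Bn*Cn*Ad*vz⁻¹*P⁻¹*G⁻¹*y1*x2*y2)
  · trans (QM*Qn⁻¹*Qd⁻¹*t1*Bn*Cn*Ad*vz⁻¹*P⁻¹*G⁻¹*y1*x2*y2)*(w*w⁻¹)
    · generalize w⁻¹ = wi, Qn⁻¹ = Qi, Qd⁻¹ = Qdi, vz⁻¹ = vi, P⁻¹ = Pi, G⁻¹ = Gi
      ring
    · rw [ew]; ring
  · symm
    trans (QM*Qn⁻¹*Qd⁻¹*t1*Bn*Cn*Ad*vz⁻¹*P⁻¹*G⁻¹*y1*x2*y2)*((x1*x1⁻¹)*(x3*x3⁻¹)*(x4*x4⁻¹))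
    · generalize x1⁻¹ = x1i, x3⁻¹ = x3i, x4⁻¹ = x4i, Qn⁻¹ = Qi, Qd⁻¹ = Qdi, vz⁻¹ = vi, P⁻¹ = Pi, G⁻¹ = Gi
      ring
    · rw [e1, e3, e4]; ring

theorem Omn_u {q v a b c : ℂ} {L : ℕ} (g : Good q a b c L) (hv : v^2 = q*b) (M n : ℕ) (hM : M+1 ≤ L)
    (hn : n ≤ M+1) :
    Omn q v a b c M n * ((1-q*q^M)*(1-a*b*c*q^2*q^n*q^M)*(1-a*q*q^M/q^n)*v)
     = Omn q v a b c (M+1) n * ((1-q*q^M/q^n)*(1-a*b*c*q^2*q^M)*(1-b*c*q^2*q^n*q^M)) := by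
  have hq := g.q0
  have hv0 : v ≠ 0 := by
    rintro rfl
    have := mul_ne_zero hq g.b0
    apply this; rw [← hv]; simp
  rcases lt_or_eq_of_le hn with h | h
  · obtain ⟨d, rfl⟩ : ∃ d, M = n + d := ⟨M-n, by omega⟩
    unfold Omn
    rw [if_pos (by omega), if_pos (by omega)]
    rw [show n+d-n = d by omega, show n+d+1-n = d+1 by omega]
    have hz : v^(2*(n:ℤ)-((n+d:ℕ):ℤ)) = v^(2*(n:ℤ)-((n+d+1:ℕ):ℤ)) * v := by
      rw [← zpow_add_one₀ hv0]; congr 1; push_cast; ring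
    have e5 : 1 - a*b*c*q^(n+d+2) ≠ 0 := g.habc _ (by omega)
    have sh : poch q (a*b*c*q^(n+d+1+2)) n = poch q (a*b*c*q^(n+d+2)) n * (1 - a*b*c*q^(n+d+2)*q^n) / (1 - a*b*c*q^(n+d+2)) := by
      rw [eq_div_iff e5, ← poch_shift, mul_comm]; congr 2; ring
    rw [sh, hz, poch_succ q q d, poch_succ q (q*a) d, poch_succ q q (n+d), poch_succ q (b*c*q^(n+1)) (n+d+1)]
    have := auxu (poch q q (n+d)) (poch q q n) (poch q q d) (1 - q*q^d) (1 - a*b*c*q^(n+d+2)*q^n) (1 - a*b*c*q^(n+d+2))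
      (1 - b*c*q^(n+1)*q^(n+d+1)) (1 - q*q^(n+d)) (1-q*a*q^d) (1-b*c*q^(2*n+1))
      (poch q (q*b) n) (poch q (a*b*c*q^(n+d+2)) n) (poch q (q*a) d) (v^(2*(n:ℤ)-((n+d+1:ℕ):ℤ))) v
      (poch q (b*c*q^(n+1)) (n+d+1)) (poch q (q*c) n)
      (by have := g.h1 (d+1) (by omega) (by omega); rwa [show q*q^d = q^(d+1) by ring])
      e5
      (by have := g.hbc (n+1+(n+d+1)) (by omega); rwa [show b*c*q^(n+1)*q^(n+d+1) = b*c*q^(n+1+(n+d+1)) by ring])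
      hv0
    have hU := pow_ne_zero n hq
    have e1 : q*q^(n+d)/q^n = q*q^d := by field_simp; ring
    have e2 : a*q*q^(n+d)/q^n = q*a*q^d := by rw [mul_assoc, mul_div_assoc, e1]; ring
    rw [e1, e2]
    convert this using 2 <;> ring
  · subst h
    have : Omn q v a b c M (M+1) = 0 := by simp [Omn]
    rw [this, show q*q^M = q^(M+1) by ring, div_self (pow_ne_zero (M+1) hq)]; ring

theorem Omn_big (q v a b c : ℂ) (M n : ℕ) (h : M < n) : Omn q v a b c M n = 0 := by
  unfold Omn; rw [if_neg (by omega)]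

theorem Om_eq (q s a b c t : ℂ) (M n : ℕ) : Om q s a b c t M n = Omn q (s*t) a b c M n := by
  unfold Om Omn binom
  by_cases h : n ≤ M
  · rw [if_pos h, if_pos (by constructor <;> omega)]
    simp only [Int.toNat_natCast]
    rw [show ((M:ℤ)-(n:ℤ)).toNat = M-n by omega, show ((M:ℤ)+1).toNat = M+1 by omega]
    have e1 : q^(2*(n:ℤ)+1) = q^(2*n+1) := by exact_mod_cast zpow_natCast q (2*n+1)
    have e2 : q^((M:ℤ)+2) = q^(M+2) := by exact_mod_cast zpow_natCast q (M+2)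
    have e3 : q^((n:ℤ)+1) = q^(n+1) := by exact_mod_cast zpow_natCast q (n+1)
    rw [e1, e2, e3]
  · rw [if_neg h, if_neg (by omega)]; simp

theorem p_eq (q s a b c t : ℂ) (hq : q ≠ 0) (M n x : ℕ) (hx : x ≤ M) :
    p q s a b c t M n x = Omn q (s*t) a b c M n * Rr q a b c M n x := by
  unfold p
  by_cases h : n ≤ M
  · rw [if_pos (by omega), Om_eq]
    congr 1
    unfold Rr
    simp only [Int.toNat_natCast]
    have e2 : q^((M:ℤ)+2) = q^(M+2) := by exact_mod_cast zpow_natCast q (M+2)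
    have e3 : q^((n:ℤ)+1) = q^(n+1) := by exact_mod_cast zpow_natCast q (n+1)
    have e4 : q^((x:ℤ)+1) = q^(x+1) := by exact_mod_cast zpow_natCast q (x+1)
    rw [e2, e3, e4]
    simp only [zpow_neg, zpow_natCast]
    rw [← Finset.sum_subset (Finset.range_mono (show n+1 ≤ M+1 by omega))]
    · refine Finset.sum_congr rfl fun k _ => ?_
      unfold nu de ev; ring
    · intro k _ hk
      rw [nu_big q _ n k hq (by simpa using hk)]; simp
  · rw [if_neg (by omega), Omn_big _ _ _ _ _ _ _ (by omega), zero_mul]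

theorem p_zero (q s a b c t : ℂ) (M n x : ℤ) (h : ¬ (0 ≤ n ∧ n ≤ M ∧ 0 ≤ x ∧ x ≤ M)) :
    p q s a b c t M n x = 0 := by
  unfold p; rw [if_neg h]

end qR

namespace qR

/-- (R), up -/
theorem cR (q a b c U D W O0 O1 : ℂ) (hW : W ≠ 0) (hU : U ≠ 0) (hD : D ≠ 0) (hWD : W = U*D)
    (d1 : 1-b*c*q*U^2 ≠ 0) (d2 : 1-b*c*q^2*U^2 ≠ 0) (d3 : 1-b*c*q^3*U^2 ≠ 0)
    (hr : O1*((1-q*U)*(1-b*c*q*U^2)*(1-a*D)*(q*b)*(1-b*c*q^2*U*W)*(1-c*q*U))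
      = O0*((1-D)*(1-b*c*q^3*U^2)*(1-b*q*U)*(1-a*b*c*q^2*U*W)*(1-b*c*q*U))) :
    (-b*q*(1-q*U)*(1-a*D)*(1-b*c*q^2*U*W)*(1-c*q*U)/(D*((1-b*c*q^2*U^2)*(1-b*c*q^3*U^2)))) * O1
     = (-(1-D)*(1-a*b*c*q^2*U*W)*(1-b*q*U)*(1-b*c*q*U)/(D*((1-b*c*q*U^2)*(1-b*c*q^2*U^2)))) * O0 := by
  generalize 1-b*c*q*U^2 = e1 at *
  generalize 1-b*c*q^2*U^2 = e2 at *
  generalize 1-b*c*q^3*U^2 = e3 at *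
  generalize 1-q*U = f1 at *
  generalize 1-a*D = f2 at *
  generalize 1-b*c*q^2*U*W = f3 at *
  generalize 1-c*q*U = f4 at *
  generalize 1-D = f5 at *
  generalize 1-b*q*U = f6 at *
  generalize 1-a*b*c*q^2*U*W = f7 at *
  generalize 1-b*c*q*U = f8 at *
  rw [div_mul_eq_mul_div, div_mul_eq_mul_div, div_eq_div_iff (by positivity) (by positivity)]
  linear_combination (-D*e2) * hr

/-- (C+), up -/
theorem cPp (q v a b c U D W O0 O1 P0 : ℂ) (hD : D ≠ 0)
    (d1 : 1-b*c*q*U^2 ≠ 0) (d2 : 1-b*c*q^2*U^2 ≠ 0) (d3 : 1-b*c*q^3*U^2 ≠ 0)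
    (d4 : 1-q*W ≠ 0) (d5 : 1-b*c*q^2*U*W ≠ 0)
    (hr : O1*((1-q*U)*(1-b*c*q*U^2)*(1-a*D)*(q*b)*(1-b*c*q^2*U*W)*(1-c*q*U))
      = O0*((1-D)*(1-b*c*q^3*U^2)*(1-b*q*U)*(1-a*b*c*q^2*U*W)*(1-b*c*q*U)))
    (hu : O0*((1-q*W)*(1-a*b*c*q^2*U*W)*(1-a*q*D)*v)
     = P0*((1-q*D)*(1-a*b*c*q^2*W)*(1-b*c*q^2*U*W))) :
    (-v*b*q*U*(1-q*U)*(1-a*D)*(1-a*q*D)*(1-c*q*U)/(D*((1-b*c*q^2*U^2)*(1-b*c*q^3*U^2)))) * O1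
     = (-U*(1-D)*(1-q*D)*(1-b*q*U)*(1-b*c*q*U)*(1-a*b*c*q^2*W)
          /(D*((1-b*c*q*U^2)*(1-b*c*q^2*U^2)*(1-q*W)))) * P0 := by
  generalize 1-b*c*q*U^2 = e1 at *
  generalize 1-b*c*q^2*U^2 = e2 at *
  generalize 1-b*c*q^3*U^2 = e3 at *
  generalize 1-q*U = f1 at *
  generalize 1-a*D = f2 at *
  generalize 1-b*c*q^2*U*W = f3 at *
  generalize 1-c*q*U = f4 at *
  generalize 1-D = f5 at *
  generalize 1-b*q*U = f6 at *
  generalize 1-a*b*c*q^2*U*W = f7 at *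
  generalize 1-b*c*q*U = f8 at *
  generalize 1-q*W = f9 at *
  generalize 1-a*q*D = f10 at *
  generalize 1-q*D = f11 at *
  generalize 1-a*b*c*q^2*W = f12 at *
  rw [div_mul_eq_mul_div, div_mul_eq_mul_div, div_eq_div_iff (by positivity) (by positivity)]
  apply mul_right_cancel₀ d5
  linear_combination (-D*U*v*f10*f9*e2) * hr + (-D*U*e2*f5*e3*f6*f8) * hu

/-- (C+), down; here `U = q^m`, coefficient at `m+1` -/
theorem cPm (q v a b c U D W O0 P0 P1 : ℂ) (hv : v^2 = q*b) (hW : W ≠ 0) (hc : c ≠ 0) (hv0 : v ≠ 0) (hq : q ≠ 0)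
    (d1 : 1-b*c*q*U^2 ≠ 0) (d2 : 1-b*c*q^2*U^2 ≠ 0) (d3 : 1-b*c*q^3*U^2 ≠ 0)
    (d4 : 1-q*W ≠ 0) (d5 : 1-a*q*D ≠ 0) (d6 : 1-q*D ≠ 0)
    (hr : P1*((1-q*U)*(1-b*c*q*U^2)*(1-a*q*D)*(q*b)*(1-b*c*q^3*U*W)*(1-c*q*U))
      = P0*((1-q*D)*(1-b*c*q^3*U^2)*(1-b*q*U)*(1-a*b*c*q^3*U*W)*(1-b*c*q*U)))
    (hu : O0*((1-q*W)*(1-a*b*c*q^2*U*W)*(1-a*q*D)*v)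
     = P0*((1-q*D)*(1-a*b*c*q^2*W)*(1-b*c*q^2*U*W))) :
    (-(1-a*b*c*q^2*U*W)*(1-a*b*c*q^3*U*W)*(1-b*q*U)*(1-b*c*q*U)/(c*q*W*v*((1-b*c*q*U^2)*(1-b*c*q^2*U^2)))) * O0
     = (-(1-q*U)*(1-c*q*U)*(1-b*c*q^2*U*W)*(1-b*c*q^3*U*W)*(1-a*b*c*q^2*W)
          /(c*q*W*((1-b*c*q^2*U^2)*(1-b*c*q^3*U^2)*(1-q*W)))) * P1 := by
  generalize 1-b*c*q*U^2 = e1 at *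
  generalize 1-b*c*q^2*U^2 = e2 at *
  generalize 1-b*c*q^3*U^2 = e3 at *
  generalize 1-q*U = f1 at *
  generalize 1-b*c*q^3*U*W = f2 at *
  generalize 1-b*c*q^2*U*W = f3 at *
  generalize 1-c*q*U = f4 at *
  generalize 1-b*q*U = f6 at *
  generalize 1-a*b*c*q^2*U*W = f7 at *
  generalize 1-b*c*q*U = f8 at *
  generalize 1-q*W = f9 at *
  generalize 1-a*q*D = f10 at *
  generalize 1-q*D = f11 at *
  generalize 1-a*b*c*q^2*W = f12 at *
  generalize 1-a*b*c*q^3*U*W = f13 at *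
  rw [div_mul_eq_mul_div, div_mul_eq_mul_div, div_eq_div_iff (by positivity) (by positivity)]
  apply mul_right_cancel₀ (mul_ne_zero (mul_ne_zero d5 d6) hv0)
  linear_combination (c*q*W*f12*f3*e2*f11) * hr - (c*q*W*f13*f6*f8*e2*e3*f11)*hu
     + (c*q*W*P1*f1*f4*f3*f2*f12*e1*e2*f10*f11) * hv

/-- (C-), up; W = q^(l+1), O at l, P at l+1 -/
theorem cMp (q v a b c U D W O0 P0 P1 : ℂ) (hv : v^2 = q*b) (hW : W ≠ 0) (hv0 : v ≠ 0)
    (d1 : 1-b*c*q*U^2 ≠ 0) (d2 : 1-b*c*q^2*U^2 ≠ 0) (d3 : 1-b*c*q^3*U^2 ≠ 0)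
    (d4 : 1-a*b*c*q*W ≠ 0) (d5 : 1-a*D ≠ 0) (d6 : 1-D ≠ 0)
    (hr : P1*((1-q*U)*(1-b*c*q*U^2)*(1-a*D)*(q*b)*(1-b*c*q^2*U*W)*(1-c*q*U))
      = P0*((1-D)*(1-b*c*q^3*U^2)*(1-b*q*U)*(1-a*b*c*q^2*U*W)*(1-b*c*q*U)))
    (hu : O0*((1-W)*(1-a*b*c*q*U*W)*(1-a*D)*v)
     = P0*((1-D)*(1-a*b*c*q*W)*(1-b*c*q*U*W))) :
    (-v*(1-q*U)*(1-c*q*U)*(1-b*c*q*U*W)*(1-b*c*q^2*U*W)/(W*((1-b*c*q^2*U^2)*(1-b*c*q^3*U^2)))) * P1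
     = (-(1-b*q*U)*(1-b*c*q*U)*(1-a*b*c*q*U*W)*(1-a*b*c*q^2*U*W)*(1-W)
          /(W*((1-b*c*q*U^2)*(1-b*c*q^2*U^2)*(1-a*b*c*q*W)))) * O0 := by
  generalize 1-b*c*q*U^2 = e1 at *
  generalize 1-b*c*q^2*U^2 = e2 at *
  generalize 1-b*c*q^3*U^2 = e3 at *
  generalize 1-q*U = f1 at *
  generalize 1-b*c*q*U*W = f2 at *
  generalize 1-b*c*q^2*U*W = f3 at *
  generalize 1-c*q*U = f4 at *
  generalize 1-b*q*U = f6 at *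
  generalize 1-a*b*c*q^2*U*W = f7 at *
  generalize 1-b*c*q*U = f8 at *
  generalize 1-W = f9 at *
  generalize 1-a*D = f10 at *
  generalize 1-D = f11 at *
  generalize 1-a*b*c*q*W = f12 at *
  generalize 1-a*b*c*q*U*W = f13 at *
  rw [div_mul_eq_mul_div, div_mul_eq_mul_div, div_eq_div_iff (by positivity) (by positivity)]
  apply mul_right_cancel₀ (mul_ne_zero (mul_ne_zero d5 d6) hv0)
  linear_combination (-W*f2*e2*f11*f12) * hr + (W*f6*f8*f7*e2*e3*f11)*hu
     + (-W*P1*f1*f4*f2*f3*e1*e2*f12*f10*f11) * hv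

/-- (C-), down; `U = q^m`, `D = W/(qU)`; O1 at (l,m+1), P at l+1 -/
theorem cMm (q v a b c U D W O1 P0 P1 : ℂ) (hv : v^2 = q*b) (hW : W ≠ 0) (hv0 : v ≠ 0) (hq : q ≠ 0) (hD : D ≠ 0)
    (hU : U ≠ 0)
    (d1 : 1-b*c*q*U^2 ≠ 0) (d2 : 1-b*c*q^2*U^2 ≠ 0) (d3 : 1-b*c*q^3*U^2 ≠ 0)
    (d4 : 1-a*b*c*q*W ≠ 0) (d5 : 1-a*b*c*q^2*U*W ≠ 0) (hWD : W = q*U*D)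
    (hr : P1*((1-q*U)*(1-b*c*q*U^2)*(1-a*q*D)*(q*b)*(1-b*c*q^2*U*W)*(1-c*q*U))
      = P0*((1-q*D)*(1-b*c*q^3*U^2)*(1-b*q*U)*(1-a*b*c*q^2*U*W)*(1-b*c*q*U)))
    (hu : O1*((1-W)*(1-a*b*c*q^2*U*W)*(1-a*D)*v)
     = P1*((1-D)*(1-a*b*c*q*W)*(1-b*c*q^2*U*W))) :
    (-c*v*U*(1-q*D)*(1-D)*(1-b*q*U)*(1-b*c*q*U)/(D*((1-b*c*q*U^2)*(1-b*c*q^2*U^2)))) * P0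
     = (-c*q^2*b^2*U*(1-q*U)*(1-c*q*U)*(1-a*q*D)*(1-a*D)*(1-W)
          /(D*((1-b*c*q^2*U^2)*(1-b*c*q^3*U^2)*(1-a*b*c*q*W)))) * O1 := by
  clear hWD
  generalize 1-b*c*q*U^2 = e1 at *
  generalize 1-b*c*q^2*U^2 = e2 at *
  generalize 1-b*c*q^3*U^2 = e3 at *
  generalize 1-q*U = f1 at *
  generalize 1-b*c*q^2*U*W = f3 at *
  generalize 1-c*q*U = f4 at *
  generalize 1-b*q*U = f6 at *
  generalize 1-a*b*c*q^2*U*W = f7 at *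
  generalize 1-b*c*q*U = f8 at *
  generalize 1-W = f9 at *
  generalize 1-a*q*D = f10 at *
  generalize 1-q*D = f11 at *
  generalize 1-a*b*c*q*W = f12 at *
  generalize 1-D = f13 at *
  generalize 1-a*D = f14 at *
  rw [div_mul_eq_mul_div, div_mul_eq_mul_div, div_eq_div_iff (by positivity) (by positivity)]
  apply mul_right_cancel₀ (mul_ne_zero d5 hv0)
  linear_combination (c*v^2*U*f13*e2*f12*D) * hr + (D*c*q^2*b^2*U*f1*f4*f10*e1*e2)*hu
     + (-D*c*U*P1*q*b*f13*f1*f4*f10*e1*e2*f12*f3) * hv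
end qR

namespace qR

theorem m1 (q a b c U D : ℂ) :
   c*q*b^2*U^2*(1-U)*(1-c*U)*(1-a*q*D)*(1-a*D)*(1-b*c*q^2*U^2)
     + (1-b*q*U)*(1-b*c*q*U)*(1-a*b*c*q*U*(U*D))*(1-a*b*c*q^2*U*(U*D))*(1-b*c*U^2)
     - (1-a*b*q*(U*D))*(1-a*b*c*q*(U*D))*((1-b*c*U^2)*(1-b*c*q*U^2)*(1-b*c*q^2*U^2))
   = q*b*(1-a*b*c*q*U*(U*D))*(1-a*D)*(1-b*c*q*U^2)*(c*U^2*(1+q)*(1+b)-U*(1+c)*(1+q*b*c*U^2)) := by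
  ring

theorem m2 (q b c U D : ℂ) :
   (1-U)*(1-c*U)*(1-b*c*U*(U*D))*(1-b*c*q*U*(U*D))*(1-b*c*q^2*U^2)
     + c*U^2*(1-D)*(q-D)*(1-b*q*U)*(1-b*c*q*U)*(1-b*c*U^2)
     - (1-c*(U*D))*(1-U*D)*((1-b*c*U^2)*(1-b*c*q*U^2)*(1-b*c*q^2*U^2))
   = (1-D)*(1-b*c*q*U*(U*D))*(1-b*c*q*U^2)*(c*U^2*(1+q)*(1+b)-U*(1+c)*(1+q*b*c*U^2)) := by
  ring

theorem div3 (X Y Z w e0 e1 e2 : ℂ) (hw : w ≠ 0) (h0 : e0 ≠ 0) (h1 : e1 ≠ 0) (h2 : e2 ≠ 0) :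
   X/(w*(e0*e1)) + Y/(w*(e1*e2)) - Z/w = (X*e2 + Y*e0 - Z*(e0*e1*e2))/(w*(e0*e1*e2)) := by
  field_simp

/-- (C-), zero. O at (l,n), P at (l+1,n) -/
theorem cM0 (q v a b c U D W O0 P0 : ℂ) (hv : v^2 = q*b) (hW : W ≠ 0) (hv0 : v ≠ 0)
    (d0 : 1-b*c*U^2 ≠ 0) (d1 : 1-b*c*q*U^2 ≠ 0) (d2 : 1-b*c*q^2*U^2 ≠ 0)
    (d4 : 1-a*b*c*q*W ≠ 0) (hWD : W = U*D)
    (hu : O0*((1-W)*(1-a*b*c*q*U*W)*(1-a*D)*v)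
     = P0*((1-D)*(1-a*b*c*q*W)*(1-b*c*q*U*W))) :
    v*((1-U)*(1-c*U)*(1-b*c*U*W)*(1-b*c*q*U*W)/(W*((1-b*c*U^2)*(1-b*c*q*U^2)))
      + c*U^2*(1-D)*(q-D)*(1-b*q*U)*(1-b*c*q*U)/(W*((1-b*c*q*U^2)*(1-b*c*q^2*U^2)))
      - (1-c*W)*(1-W)/W) * P0
     = (c*q*b^2*U^2*(1-U)*(1-c*U)*(1-a*q*D)*(1-a*D)/(W*((1-b*c*U^2)*(1-b*c*q*U^2)))
      + (1-b*q*U)*(1-b*c*q*U)*(1-a*b*c*q*U*W)*(1-a*b*c*q^2*U*W)/(W*((1-b*c*q*U^2)*(1-b*c*q^2*U^2)))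
      - (1-a*b*q*W)*(1-a*b*c*q*W)/W)*((1-W)/(1-a*b*c*q*W)) * O0 := by
  rw [div3 _ _ _ _ _ _ _ hW d0 d1 d2, div3 _ _ _ _ _ _ _ hW d0 d1 d2]
  have E1 := m1 q a b c U D
  have E2 := m2 q b c U D
  rw [← hWD] at E1 E2
  rw [E1, E2]
  generalize c*U^2*(1+q)*(1+b)-U*(1+c)*(1+q*b*c*U^2) = Z
  generalize 1-b*c*U^2 = e0 at *
  generalize 1-b*c*q*U^2 = e1 at *
  generalize 1-b*c*q^2*U^2 = e2 at *
  generalize 1-b*c*q*U*W = f1 at *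
  generalize 1-a*b*c*q*U*W = f2 at *
  generalize 1-a*b*c*q*W = f3 at *
  generalize 1-a*D = f4 at *
  generalize 1-D = f5 at *
  generalize 1-W = f6 at *
  have : P0*f5*f1 = O0*f6*f2*f4*v/f3 := by
    rw [eq_div_iff d4]; linear_combination -hu
  generalize hX : (W*(e0*e1*e2)) = X
  trans v*e1*Z/X*(P0*f5*f1)
  · ring
  · rw [this]; 
    trans v^2*e1*Z*O0*f6*f2*f4/X/f3
    · ring
    · rw [hv]; ring

/-- (C+), zero. O at (M,n), P at (M+1,n); `D' = q W/U`, `W' = q W` -/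
theorem cP0 (q v a b c U D W O0 P0 : ℂ) (hv : v^2 = q*b) (hW : W ≠ 0) (hv0 : v ≠ 0) (hc : c ≠ 0)
    (d0 : 1-b*c*U^2 ≠ 0) (d1 : 1-b*c*q*U^2 ≠ 0) (d2 : 1-b*c*q^2*U^2 ≠ 0)
    (d4 : 1-W ≠ 0) (d5 : 1-a*b*c*q*U*W ≠ 0) (d6 : 1-a*D ≠ 0) (hWD : W = U*D)
    (hu : O0*((1-W)*(1-a*b*c*q*U*W)*(1-a*D)*v)
     = P0*((1-D)*(1-a*b*c*q*W)*(1-b*c*q*U*W))) :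
    ((c*q*b^2*U^2*(1-U)*(1-c*U)*(1-a*q*D)*(1-a*D)/(W*((1-b*c*U^2)*(1-b*c*q*U^2)))
      + (1-b*q*U)*(1-b*c*q*U)*(1-a*b*c*q*U*W)*(1-a*b*c*q^2*U*W)/(W*((1-b*c*q*U^2)*(1-b*c*q^2*U^2)))
      - (1-a*b*q*W)*(1-a*b*c*q*W)/W)/(c*v)) * O0
     = ((1-U)*(1-c*U)*(1-b*c*U*W)*(1-b*c*q*U*W)/(W*((1-b*c*U^2)*(1-b*c*q*U^2)))
      + c*U^2*(1-D)*(q-D)*(1-b*q*U)*(1-b*c*q*U)/(W*((1-b*c*q*U^2)*(1-b*c*q^2*U^2)))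
      - (1-c*W)*(1-W)/W)*((1-a*b*c*q*W)/(1-W))/c * P0 := by
  rw [div3 _ _ _ _ _ _ _ hW d0 d1 d2, div3 _ _ _ _ _ _ _ hW d0 d1 d2]
  have E1 := m1 q a b c U D
  have E2 := m2 q b c U D
  rw [← hWD] at E1 E2
  rw [E1, E2]
  generalize c*U^2*(1+q)*(1+b)-U*(1+c)*(1+q*b*c*U^2) = Z
  generalize 1-b*c*U^2 = e0 at *
  generalize 1-b*c*q*U^2 = e1 at *
  generalize 1-b*c*q^2*U^2 = e2 at *
  generalize 1-b*c*q*U*W = f1 at *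
  generalize 1-a*b*c*q*U*W = f2 at *
  generalize 1-a*b*c*q*W = f3 at *
  generalize 1-a*D = f4 at *
  generalize 1-D = f5 at *
  generalize 1-W = f6 at *
  have : O0*f2*f4*v = P0*f5*f3*f1/f6 := by
    rw [eq_div_iff d4]; linear_combination hu
  generalize hX : (W*(e0*e1*e2)) = X
  trans e1*Z/X/c*(O0*f2*f4*v)
  · rw [← hv]; field_simp
  · rw [this]; ring
end qR

namespace qR

theorem z1 (q : ℂ) (hq : q ≠ 0) (n : ℤ) : q^(2*n) = q^n*q^n := by rw [two_mul, zpow_add₀ hq]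

theorem PhiP_eq (q a b c : ℂ) (hq : q ≠ 0) (N n : ℤ) (U W : ℂ) (hU : q^n = U) (hW : q^N = W) :
    PhiP q a b c N n = -b*(U/W)*(1-U)*(1-a*(W/U*q))*(1-b*c*(U*W*q))*(1-c*U)
      /((1-b*c*(U*U))*(1-b*c*(U*U*q))) := by
  subst hU hW
  simp only [PhiP, zpow_add₀ hq, zpow_sub₀ hq, zpow_one, z1 q hq]

theorem PhiM_eq (q a b c : ℂ) (hq : q ≠ 0) (N n : ℤ) (U W : ℂ) (hU : q^n = U) (hW : q^N = W) :
    PhiM q a b c N n = (1-U/W)*(1-a*b*c*(U*W*q^2))*(1-b*(U*q))*(1-b*c*(U*q))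
      /((1-b*c*(U*U*q))*(1-b*c*(U*U*q^2))) := by
  subst hU hW
  simp only [PhiM, zpow_add₀ hq, zpow_sub₀ hq, zpow_one, z1 q hq, zpow_ofNat, pow_one]

theorem PhiPp_eq (q v a b c : ℂ) (hq : q ≠ 0) (N n : ℤ) (U W : ℂ) (hU : q^n = U) (hW : q^N = W) :
    PhiPp q v a b c N n = -v*b*(U*U/W/q)*(1-U)*(1-a*(W/U*q))*(1-a*(W*q^2/U))*(1-c*U)
      /((1-b*c*(U*U))*(1-b*c*(U*U*q))) := by
  subst hU hW
  simp only [PhiPp, zpow_add₀ hq, zpow_sub₀ hq, zpow_one, z1 q hq, zpow_ofNat, pow_one]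

theorem PhiPm_eq (q v a b c : ℂ) (hq : q ≠ 0) (N n : ℤ) (U W : ℂ) (hU : q^n = U) (hW : q^N = W) :
    PhiPm q v a b c N n = -((1-a*b*c*(U*W*q^2))*(1-a*b*c*(U*W*q^3))*(1-b*(U*q))*(1-b*c*(U*q)))
      /(c*(W*q)*v*(1-b*c*(U*U*q))*(1-b*c*(U*U*q^2))) := by
  subst hU hW
  simp only [PhiPm, zpow_add₀ hq, zpow_sub₀ hq, zpow_one, z1 q hq, zpow_ofNat, pow_one]

theorem PhiP0_eq (q v a b c : ℂ) (hq : q ≠ 0) (N n : ℤ) (W : ℂ) (hW : q^N = W) :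
    PhiP0 q v a b c N n = -PhiPp q v a b c N n - PhiPm q v a b c N n
      - (1-a*b*(W*q^2))*(1-a*b*c*(W*q^2))/(c*(W*q)*v) := by
  subst hW
  simp only [PhiP0, zpow_add₀ hq, zpow_one, zpow_ofNat, pow_one]

theorem PhiMp_eq (q v a b c : ℂ) (hq : q ≠ 0) (N n : ℤ) (U W : ℂ) (hU : q^n = U) (hW : q^N = W) :
    PhiMp q v a b c N n = -v*(1-U)*(1-c*U)*(1-b*c*(U*W))*(1-b*c*(U*W*q))
      /(W*(1-b*c*(U*U))*(1-b*c*(U*U*q))) := by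
  subst hU hW
  simp only [PhiMp, zpow_add₀ hq, zpow_sub₀ hq, zpow_one, z1 q hq, zpow_ofNat, pow_one]

theorem PhiMm_eq (q v a b c : ℂ) (hq : q ≠ 0) (N n : ℤ) (U W : ℂ) (hU : q^n = U) (hW : q^N = W) :
    PhiMm q v a b c N n = -c*v*W*(1-U/W)*(1-U/W*q)*(1-b*(U*q))*(1-b*c*(U*q))
      /((1-b*c*(U*U*q))*(1-b*c*(U*U*q^2))) := by
  subst hU hW
  simp only [PhiMm, zpow_add₀ hq, zpow_sub₀ hq, zpow_one, z1 q hq, zpow_ofNat, pow_one]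

theorem PhiM0_eq (q v a b c : ℂ) (N n : ℤ) (W : ℂ) (hW : q^N = W) :
    PhiM0 q v a b c N n = -PhiMp q v a b c N n - PhiMm q v a b c N n
      - v*(1-c*W)*(W⁻¹-1) := by
  subst hW
  simp only [PhiM0, zpow_neg]

/-- three-term combination -/
theorem comb (q s t a b c μ P Z D X Y Y' : ℂ) (hq : q ≠ 0) (M M' n x : ℕ) (hx : x ≤ M')
    (O : ℂ)
    (h : μ * Rr q a b c M n x = P * Rr q a b c M' (n+1) x + Z * Rr q a b c M' n x + D * RrP q a b c M' n x)
    (h1 : X * Omn q (s*t) a b c M' (n+1) = P * O)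
    (h2 : Y * Omn q (s*t) a b c M' n = Z * O)
    (h3 : ∀ m, n = m+1 → Y' * Omn q (s*t) a b c M' m = D * O) :
    μ * (O * Rr q a b c M n x) = X * p q s a b c t M' ((n:ℤ)+1) x + Y * p q s a b c t M' n x
      + Y' * p q s a b c t M' ((n:ℤ)-1) x := by
  rw [show ((n:ℤ)+1) = ((n+1:ℕ):ℤ) by push_cast; ring, p_eq q s a b c t hq M' (n+1) x hx,
    p_eq q s a b c t hq M' n x hx]
  rcases n with _ | m
  · rw [p_zero _ _ _ _ _ _ _ _ _ (by simp)]
    have : RrP q a b c M' 0 x = 0 := by simp [RrP, nuP]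
    rw [this] at h
    linear_combination O*h - Rr q a b c M' (0+1) x * h1 - Rr q a b c M' 0 x * h2
  · rw [RrP_succ] at h
    rw [show (((m+1:ℕ):ℤ)-1) = ((m:ℕ):ℤ) by push_cast; ring, p_eq q s a b c t hq M' m x hx]
    linear_combination O*h - Rr q a b c M' (m+1+1) x * h1 - Rr q a b c M' (m+1) x * h2 - Rr q a b c M' m x * h3 m rfl

theorem lam_eq (q f : ℂ) (x : ℕ) : lam q f x = lamn q f x := by
  unfold lam lamn
  have e3 : q^((x:ℤ)+1) = q^(x+1) := by exact_mod_cast zpow_natCast q (x+1)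
  rw [e3, zpow_neg, zpow_natCast]

theorem recR_O {q v a b c : ℂ} {L : ℕ} (g : Good q a b c L) (hv : v^2 = q*b) (M n : ℕ) (hM : M ≤ L)
    (hn : n ≤ M) : PhiP q a b c M ((n:ℤ)+1) * Omn q v a b c M (n+1) = PhiM q a b c M n * Omn q v a b c M n := by
  have hq := g.q0
  have hr := Omn_r g hv M n hM
  have hU : q^n ≠ 0 := pow_ne_zero _ hq
  have hW : q^M ≠ 0 := pow_ne_zero _ hq
  obtain ⟨_, d1, d2⟩ := dens g n (by omega)
  obtain ⟨_, d3, _⟩ := dens g (n+1) (by omega)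
  rw [PhiP_eq q a b c hq M (n+1) (q*q^n) (q^M) (by rw [zpow_add₀ hq, zpow_natCast, zpow_one]; ring) (zpow_natCast _ _),
    PhiM_eq q a b c hq M n (q^n) (q^M) (zpow_natCast _ _) (zpow_natCast _ _)]
  rw [pow_succ q n] at d3
  generalize q^n = U at *
  generalize q^M = W at *
  rw [show 1 - b*c*q*(U*q)^2 = 1 - b*c*q^3*U^2 by ring] at d3
  have hD : W/U ≠ 0 := div_ne_zero hW hU
  have := cR q a b c U (W/U) W _ _ hW hU hD (by field_simp) d1 d2 d3 (by rw [← mul_div_assoc]; exact hr)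
  have e1 : a*(W/(q*U)*q) = a*(W/U) := by field_simp
  have e2 : 1 - U/W = -(1-W/U)/(W/U) := by field_simp; ring
  have e3 : q*U/W = q/(W/U) := by field_simp
  rw [e1, e2, e3]
  generalize W/U = D at *
  simp only [← div_div] at this ⊢
  convert this using 1 <;> ring

/-- three-term recurrence -/
theorem pR {q s t a b c : ℂ} {L : ℕ} (g : Good q a b c L) (hv : (s*t)^2 = q*b) (M n x : ℕ) (hM : M ≤ L)
    (hn : n ≤ M) (hx : x ≤ M) :
    lam q (a*b) x * p q s a b c t M n x = PhiP q a b c M ((n:ℤ)+1) * p q s a b c t M ((n:ℤ)+1) x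
      + (-PhiP q a b c M n - PhiM q a b c M n) * p q s a b c t M n x
      + PhiM q a b c M ((n:ℤ)-1) * p q s a b c t M ((n:ℤ)-1) x := by
  have hq := g.q0
  have hB : PhiM q a b c M n = BR q a b c (q^n) (q^M) := by
    rw [PhiM_eq q a b c hq M n (q^n) (q^M) (zpow_natCast _ _) (zpow_natCast _ _)]
    unfold BR; ring
  have hD : PhiP q a b c M n = DR q a b c (q^n) (q^M) := by
    rw [PhiP_eq q a b c hq M n (q^n) (q^M) (zpow_natCast _ _) (zpow_natCast _ _)]
    unfold DR; ring
  rw [lam_eq]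
  rw [p_eq q s a b c t hq M n x hx]
  rw [← p_eq q s a b c t hq M n x hx]
  conv_lhs => rw [p_eq q s a b c t hq M n x hx]
  refine comb q s t a b c _ (BR q a b c (q^n) (q^M)) (-BR q a b c (q^n) (q^M)-DR q a b c (q^n) (q^M)) (DR q a b c (q^n) (q^M)) _ _ _ hq M M n x hx _ ?_ ?_ ?_ ?_
  · exact recR g M n x hM hn hx
  · rw [recR_O g hv M n hM hn, hB]
  · rw [hB, hD]; ring
  · rintro m rfl
    have := recR_O g hv M m hM (by omega)
    rw [← hD, show (((m+1:ℕ):ℤ)-1) = ((m:ℕ):ℤ) by push_cast; ring, ← this]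
    push_cast; rfl
end qR

namespace qR

theorem v_ne {q v b : ℂ} (hq : q ≠ 0) (hb : b ≠ 0) (hv : v^2 = q*b) : v ≠ 0 := by
  rintro rfl
  apply mul_ne_zero hq hb
  rw [← hv]; simp

theorem dens3 {q a b c : ℂ} {L : ℕ} (g : Good q a b c L) (n : ℕ) (hn : n ≤ L) :
    1 - b*c*q^3*(q^n)^2 ≠ 0 := by
  obtain ⟨_, d3, _⟩ := dens g (n+1) (by omega)
  rwa [pow_succ q n, show 1 - b*c*q*(q^n*q)^2 = 1 - b*c*q^3*(q^n)^2 by ring] at d3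

theorem recPp_O {q v a b c : ℂ} {L : ℕ} (g : Good q a b c L) (hv : v^2 = q*b) (M n : ℕ) (hM : M+1 ≤ L)
    (hn : n ≤ M+1) : PhiPp q v a b c M ((n:ℤ)+1) * Omn q v a b c M (n+1)
      = gP q a b c (q^n) (q^M) * Omn q v a b c (M+1) n := by
  have hq := g.q0
  have hr := Omn_r g hv M n (by omega)
  have hu := Omn_u g hv M n hM hn
  have hU : q^n ≠ 0 := pow_ne_zero _ hq
  have hW : q^M ≠ 0 := pow_ne_zero _ hq
  obtain ⟨_, d1, d2⟩ := dens g n (by omega)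
  have d3 := dens3 g n (by omega)
  have d4 : 1 - q*q^M ≠ 0 := by
    have := g.h1 (M+1) (by omega) hM
    rwa [pow_succ, mul_comm] at this
  have d5 : 1 - b*c*q^2*q^n*q^M ≠ 0 := by
    have := g.hbc (2+n+M) (by omega)
    rwa [show b*c*q^(2+n+M) = b*c*q^2*q^n*q^M by ring] at this
  rw [PhiPp_eq q v a b c hq M (n+1) (q*q^n) (q^M) (by rw [zpow_add₀ hq, zpow_natCast, zpow_one]; ring) (zpow_natCast _ _)]
  unfold gP
  generalize q^n = U at *
  generalize q^M = W at *
  have hD : W/U ≠ 0 := div_ne_zero hW hU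
  simp only [mul_div_assoc] at hr hu
  have := cPp q v a b c U (W/U) W _ _ _ hD d1 d2 d3 d4 d5 (by simpa only [mul_div_assoc] using hr)
    (by simpa only [mul_div_assoc, mul_assoc] using hu)
  have e1 : a*(W/(q*U)*q) = a*(W/U) := by field_simp
  have e2 : a*(W*q^2/(q*U)) = a*q*(W/U) := by field_simp
  have e3 : q*U*(q*U)/W/q = q*U/(W/U) := by field_simp
  have e4 : U^2/W = U/(W/U) := by field_simp
  rw [e1, e2, e3, e4, mul_div_assoc q W U]
  generalize W/U = D at *
  simp only [← div_div] at this ⊢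
  convert this using 1 <;> ring

theorem recPm_O {q v a b c : ℂ} {L : ℕ} (g : Good q a b c L) (hv : v^2 = q*b) (M m : ℕ) (hM : M+1 ≤ L)
    (hn : m ≤ M) : PhiPm q v a b c M (m:ℤ) * Omn q v a b c M m
      = gM q a b c (q^(m+1)) (q^M) * Omn q v a b c (M+1) (m+1) := by
  have hq := g.q0
  have hr := Omn_r g hv (M+1) m (by omega)
  have hu := Omn_u g hv M m hM (by omega)
  have hv0 := v_ne hq g.b0 hv
  have hU : q^m ≠ 0 := pow_ne_zero _ hq
  have hW : q^M ≠ 0 := pow_ne_zero _ hq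
  obtain ⟨_, d1, d2⟩ := dens g m (by omega)
  have d3 := dens3 g m (by omega)
  have d4 : 1 - q*q^M ≠ 0 := by
    have := g.h1 (M+1) (by omega) hM
    rwa [pow_succ, mul_comm] at this
  have hE : q^(M+1-m) = q*(q^M/q^m) := by
    rw [← mul_div_assoc, eq_div_iff hU, ← pow_add, show M+1-m+m = M+1 by omega]; ring
  have d5 : 1 - a*q*(q^M/q^m) ≠ 0 := by
    have := g.ha (M+1-m) (by omega)
    rwa [hE, ← mul_assoc] at this
  have d6 : 1 - q*(q^M/q^m) ≠ 0 := by
    have := g.h1 (M+1-m) (by omega) (by omega)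
    rwa [hE] at this
  rw [PhiPm_eq q v a b c hq M m (q^m) (q^M) (zpow_natCast _ _) (zpow_natCast _ _)]
  unfold gM
  rw [pow_succ q M] at hr
  rw [pow_succ q m]
  generalize q^m = U at *
  generalize q^M = W at *
  have := cPm q v a b c U (W/U) W _ _ _ hv hW g.c0 hv0 hq d1 d2 d3 d4 d5 d6
    (by convert hr using 2 <;> ring)
    (by convert hu using 2 <;> ring)
  simp only [← div_div] at this ⊢
  convert this using 1 <;> ring

theorem recP0_O {q v a b c : ℂ} {L : ℕ} (g : Good q a b c L) (hv : v^2 = q*b) (M n : ℕ) (hM : M+1 ≤ L)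
    (hn : n ≤ M+1) : PhiP0 q v a b c M (n:ℤ) * Omn q v a b c M n
      = (-muP q a b c (q^M) - gP q a b c (q^n) (q^M) - gM q a b c (q^n) (q^M)) * Omn q v a b c (M+1) n := by
  have hq := g.q0
  have hu := Omn_u g hv M n hM (by omega)
  have hv0 := v_ne hq g.b0 hv
  have hc := g.c0
  have hU : q^n ≠ 0 := pow_ne_zero _ hq
  have hW : q^M ≠ 0 := pow_ne_zero _ hq
  obtain ⟨d0, d1, d2⟩ := dens g n (by omega)
  have d4 : 1 - q*q^M ≠ 0 := by
    have := g.h1 (M+1) (by omega) hM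
    rwa [pow_succ, mul_comm] at this
  have hE : q^(M+1-n) = q*(q^M/q^n) := by
    rw [← mul_div_assoc, eq_div_iff hU, ← pow_add, show M+1-n+n = M+1 by omega]; ring
  have d5 : 1 - a*b*c*q*q^n*(q*q^M) ≠ 0 := by
    have := g.habc (2+n+M) (by omega)
    rwa [show a*b*c*q^(2+n+M) = a*b*c*q*q^n*(q*q^M) by ring] at this
  have d6 : 1 - a*(q*(q^M/q^n)) ≠ 0 := by
    have := g.ha (M+1-n) (by omega)
    rwa [hE] at this
  rw [PhiP0_eq q v a b c hq M n (q^M) (zpow_natCast _ _),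
    PhiPp_eq q v a b c hq M n (q^n) (q^M) (zpow_natCast _ _) (zpow_natCast _ _),
    PhiPm_eq q v a b c hq M n (q^n) (q^M) (zpow_natCast _ _) (zpow_natCast _ _)]
  unfold gM gP muP
  generalize q^n = U at *
  generalize q^M = W at *
  have := cP0 q v a b c U (q*(W/U)) (q*W) _ _ hv (mul_ne_zero hq hW) hv0 hc d0 d1 d2 d4 d5 d6
    (by field_simp) (by convert hu using 2 <;> ring)
  convert this using 2
  · have x1 : q*b^2/v = v*b := by rw [div_eq_iff hv0]; linear_combination -b*hv
    have x2 : v*b*(U*U/W/q) = c*q*b^2*U^2/(q*W)/(c*v) := by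
      rw [← x1]; field_simp
    have x3 : a*(W/U*q) = a*(q*(W/U)) := by ring
    have x4 : a*(W*q^2/U) = a*q*(q*(W/U)) := by ring
    rw [x3, x4]
    trans (v*b*(U*U/W/q))*((1-U)*(1-a*(q*(W/U)))*(1-a*q*(q*(W/U)))*(1-c*U)/((1-b*c*(U*U))*(1-b*c*(U*U*q))))
       + 1/(c*(W*q)*v)*((1-a*b*c*(U*W*q^2))*(1-a*b*c*(U*W*q^3))*(1-b*(U*q))*(1-b*c*(U*q))
      /((1-b*c*(U*U*q))*(1-b*c*(U*U*q^2))))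
      - (1-a*b*(W*q^2))*(1-a*b*c*(W*q^2))/(c*(W*q)*v)
    · simp only [← div_div]; ring
    · rw [x2]
      generalize q*(W/U) = D
      rw [show 1-b*c*(U*U) = 1-b*c*U^2 by ring, show 1-b*c*(U*U*q) = 1-b*c*q*U^2 by ring,
        show 1-b*c*(U*U*q^2) = 1-b*c*q^2*U^2 by ring]
      simp only [← div_div]
      generalize 1-b*c*U^2 = e0
      generalize 1-b*c*q*U^2 = e1
      generalize 1-b*c*q^2*U^2 = e2
      ring
  · have y1 : 1/(c*q*W)+a*b*c*q^2*W-1-a*b*q = (1-c*q*W)*(1-a*b*c*q^2*W)/(c*q*W) := by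
      field_simp; ring
    have y2 : (1-W/U) = (q-q*(W/U))/q := by field_simp
    have y3 : U^2/W = c*U^2/(q*W)/c*q := by field_simp
    rw [y1, y2, y3, show q*W/U = q*(W/U) by ring]
    generalize q*(W/U) = D
    have d4' : (1-q*W)*(1-q*W)⁻¹ = 1 := mul_inv_cancel₀ d4
    have qq : q*q⁻¹ = 1 := mul_inv_cancel₀ hq
    simp only [← div_div]
    trans (-((1-c*q*W)*(1-a*b*c*q^2*W)/c/q/W)*((1-q*W)*(1-q*W)⁻¹)
      + c*U^2/(q*W)/c*(q*q⁻¹)*(q-D)*(1-D)*(1-b*q*U)*(1-b*c*q*U)*(1-a*b*c*q^2*W)/(1-b*c*q*U^2)/(1-b*c*q^2*U^2)*(1-q*W)⁻¹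
      + ((1-U)*(1-c*U)*(1-b*c*q*U*W)*(1-b*c*q^2*U*W)*(1-a*b*c*q^2*W))/c/q/W/(1-b*c*U^2)/(1-b*c*q*U^2)/(1-q*W))
    · rw [d4']
      generalize 1-b*c*U^2 = e0
      generalize 1-b*c*q*U^2 = e1
      generalize 1-b*c*q^2*U^2 = e2
      generalize (1-q*W) = e3
      ring
    · rw [qq]
      generalize 1-b*c*U^2 = e0
      generalize 1-b*c*q*U^2 = e1
      generalize 1-b*c*q^2*U^2 = e2
      generalize (1-q*W) = e3
      ring

end qR

namespace qR

theorem recMp_O {q v a b c : ℂ} {L : ℕ} (g : Good q a b c L) (hv : v^2 = q*b) (l n : ℕ) (hM : l+1 ≤ L)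
    (hn : n ≤ l) : PhiMp q v a b c ((l+1:ℕ):ℤ) ((n:ℤ)+1) * Omn q v a b c (l+1) (n+1)
      = hP q a b c (q^n) (q^(l+1)) * Omn q v a b c l n := by
  have hq := g.q0
  have hr := Omn_r g hv (l+1) n (by omega)
  have hu := Omn_u g hv l n hM (by omega)
  have hv0 := v_ne hq g.b0 hv
  have hU : q^n ≠ 0 := pow_ne_zero _ hq
  have hW : q^(l+1) ≠ 0 := pow_ne_zero _ hq
  obtain ⟨_, d1, d2⟩ := dens g n (by omega)
  have d3 := dens3 g n (by omega)
  have hE : q^(l+1-n) = q^(l+1)/q^n := by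
    rw [eq_div_iff hU, ← pow_add, show l+1-n+n = l+1 by omega]
  have d4 : 1 - a*b*c*q*q^(l+1) ≠ 0 := by
    have := g.habc (1+(l+1)) (by omega)
    rwa [show a*b*c*q^(1+(l+1)) = a*b*c*q*q^(l+1) by ring] at this
  have d5 : 1 - a*(q^(l+1)/q^n) ≠ 0 := by
    have := g.ha (l+1-n) (by omega)
    rwa [hE] at this
  have d6 : 1 - (q^(l+1)/q^n) ≠ 0 := by
    have := g.h1 (l+1-n) (by omega) (by omega)
    rwa [hE] at this
  rw [PhiMp_eq q v a b c hq (l+1:ℕ) (n+1) (q*q^n) (q^(l+1)) (by rw [zpow_add₀ hq, zpow_natCast, zpow_one]; ring) (zpow_natCast _ _)]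
  unfold hP
  have hl : q^l = q^(l+1)/q := by rw [pow_succ]; field_simp
  rw [hl] at hu
  generalize q^n = U at *
  generalize q^(l+1) = W at *
  have := cMp q v a b c U (W/U) W _ _ _ hv hW hv0 d1 d2 d3 d4 d5 d6
    (by convert hr using 2; ring)
    (by convert hu using 2 <;> field_simp)
  simp only [← div_div] at this ⊢
  convert this using 1 <;> ring

theorem recMm_O {q v a b c : ℂ} {L : ℕ} (g : Good q a b c L) (hv : v^2 = q*b) (l m : ℕ) (hLl : l+1 ≤ L)
    (hn : m+1 ≤ l) : PhiMm q v a b c ((l+1:ℕ):ℤ) (m:ℤ) * Omn q v a b c (l+1) m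
      = hM q a b c (q^(m+1)) (q^(l+1)) * Omn q v a b c l (m+1) := by
  have hq := g.q0
  have hr := Omn_r g hv (l+1) m (by omega)
  have hu := Omn_u g hv l (m+1) hLl (by omega)
  have hv0 := v_ne hq g.b0 hv
  have hU : q^m ≠ 0 := pow_ne_zero _ hq
  have hW : q^(l+1) ≠ 0 := pow_ne_zero _ hq
  obtain ⟨_, d1, d2⟩ := dens g m (by omega)
  have d3 := dens3 g m (by omega)
  have d4 : 1 - a*b*c*q*q^(l+1) ≠ 0 := by
    have := g.habc (1+(l+1)) (by omega)
    rwa [show a*b*c*q^(1+(l+1)) = a*b*c*q*q^(l+1) by ring] at this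
  have d5 : 1 - a*b*c*q^2*q^m*q^(l+1) ≠ 0 := by
    have := g.habc (2+m+(l+1)) (by omega)
    rwa [show a*b*c*q^(2+m+(l+1)) = a*b*c*q^2*q^m*q^(l+1) by ring] at this
  rw [PhiMm_eq q v a b c hq (l+1:ℕ) m (q^m) (q^(l+1)) (zpow_natCast _ _) (zpow_natCast _ _)]
  unfold hM
  have hl : q^l = q^(l+1)/q := by rw [pow_succ]; field_simp
  have hm : q^(m+1) = q*q^m := by rw [pow_succ]; ring
  rw [hl, hm] at hu
  rw [hm]
  generalize q^m = U at *
  generalize q^(l+1) = W at *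
  obtain ⟨D, rfl⟩ : ∃ D, W = q*U*D := ⟨W/(q*U), by field_simp⟩
  have hD : D ≠ 0 := right_ne_zero_of_mul hW
  have := cMm q v a b c U D (q*U*D) _ _ _ hv hW hv0 hq hD hU d1 d2 d3 d4 d5 rfl
    (by rw [show a*q*D = a*(q*U*D)/U by field_simp, show q*D = q*U*D/U by field_simp]; exact hr)
    (by convert hu using 2 <;> field_simp)
  have e1 : U/(q*U*D) = 1/(q*D) := by field_simp
  have e2 : a*q*(q*U*D)/(q*U) = a*q*D := by field_simp
  have e3 : a*(q*U*D)/(q*U) = a*D := by field_simp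
  have e4 : -c*(q*b)^2*(q*U)^2/(q*U*D*q) = -c*q^2*b^2*U/D := by field_simp
  have e5 : -c*v*(q*U*D)*(1-1/(q*D))*(1-1/(q*D)*q) = -c*v*U*(1-q*D)*(1-D)/D := by field_simp; ring
  rw [e1, e2, e3, e4, e5]
  simp only [← div_div] at this ⊢
  rw [show 1-b*c*(U*U*q) = 1-b*c*q*U^2 by ring, show 1-b*c*(U*U*q^2) = 1-b*c*q^2*U^2 by ring,
    show 1-b*c*(q*U)^2 = 1-b*c*q^2*U^2 by ring, show 1-b*c*q*(q*U)^2 = 1-b*c*q^3*U^2 by ring]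
  convert this using 1 <;> ring

theorem recM0_O {q v a b c : ℂ} {L : ℕ} (g : Good q a b c L) (hv : v^2 = q*b) (l n : ℕ) (hLl : l+1 ≤ L)
    (hn : n ≤ l) : PhiM0 q v a b c ((l+1:ℕ):ℤ) (n:ℤ) * Omn q v a b c (l+1) n
      = (-lamn q (a*b) (l+1) - hP q a b c (q^n) (q^(l+1)) - hM q a b c (q^n) (q^(l+1))) * Omn q v a b c l n := by
  have hq := g.q0
  have hu := Omn_u g hv l n hLl (by omega)
  have hv0 := v_ne hq g.b0 hv
  have hU : q^n ≠ 0 := pow_ne_zero _ hq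
  have hW : q^(l+1) ≠ 0 := pow_ne_zero _ hq
  obtain ⟨d0, d1, d2⟩ := dens g n (by omega)
  have d4 : 1 - a*b*c*q*q^(l+1) ≠ 0 := by
    have := g.habc (1+(l+1)) (by omega)
    rwa [show a*b*c*q^(1+(l+1)) = a*b*c*q*q^(l+1) by ring] at this
  rw [PhiM0_eq q v a b c (l+1:ℕ) n (q^(l+1)) (zpow_natCast _ _),
    PhiMp_eq q v a b c hq (l+1:ℕ) n (q^n) (q^(l+1)) (zpow_natCast _ _) (zpow_natCast _ _),
    PhiMm_eq q v a b c hq (l+1:ℕ) n (q^n) (q^(l+1)) (zpow_natCast _ _) (zpow_natCast _ _)]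
  unfold hP hM lamn
  rw [pow_succ q (l+1)]
  have hl : q^l = q^(l+1)/q := by rw [pow_succ]; field_simp
  rw [hl] at hu
  generalize q^n = U at *
  generalize q^(l+1) = W at *
  obtain ⟨D, rfl⟩ : ∃ D, W = U*D := ⟨W/U, by field_simp⟩
  have hD : D ≠ 0 := right_ne_zero_of_mul hW
  have := cM0 q v a b c U D (U*D) _ _ hv hW hv0 d0 d1 d2 d4 rfl
    (by convert hu using 2 <;> field_simp)
  convert this using 2
  · have x1 : U/(U*D) = 1/D := by field_simp
    have x2 : -c*v*(U*D)*(1-1/D)*(1-1/D*q) = -v*(c*U^2*(1-D)*(q-D))/(U*D) := by field_simp; ring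
    have x3 : v*(1-c*(U*D))*((U*D)⁻¹-1) = v*((1-c*(U*D))*(1-U*D)/(U*D)) := by field_simp
    rw [x1, x2, x3]
    generalize U*D = W
    rw [show 1-b*c*(U*U) = 1-b*c*U^2 by ring, show 1-b*c*(U*U*q) = 1-b*c*q*U^2 by ring,
        show 1-b*c*(U*U*q^2) = 1-b*c*q^2*U^2 by ring]
    simp only [← div_div]
    generalize 1-b*c*U^2 = e0
    generalize 1-b*c*q*U^2 = e1
    generalize 1-b*c*q^2*U^2 = e2
    ring
  · have y1 : -(1-(U*D)⁻¹)*(1-a*b*(U*D*q)) = (1-a*b*q*(U*D))/(U*D)*(1-U*D) := by field_simp; ring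
    have y2 : a*q*(U*D)/U = a*q*D := by field_simp
    have y3 : a*(U*D)/U = a*D := by field_simp
    have y4 : -c*(q*b)^2*U^2/(U*D*q) = -c*q*b^2*U^2/(U*D) := by field_simp
    rw [y1, y2, y3, y4]
    generalize U*D = W at *
    have dd : (1-a*b*c*q*W)*(1-a*b*c*q*W)⁻¹ = 1 := mul_inv_cancel₀ d4
    trans -((1-a*b*q*W)/W*(1-W))*((1-a*b*c*q*W)*(1-a*b*c*q*W)⁻¹)
      - -((1-b*q*U)*(1-b*c*q*U)*(1-a*b*c*q*U*W)*(1-a*b*c*q^2*U*W)*(1-W))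
        /(W*(1-b*c*q*U^2)*(1-b*c*q^2*U^2)*(1-a*b*c*q*W))
      - -c*q*b^2*U^2/W*(1-U)*(1-c*U)*(1-a*q*D)*(1-a*D)*(1-W)
        /((1-b*c*U^2)*(1-b*c*q*U^2)*(1-a*b*c*q*W))
    · rw [dd, mul_one]
    · simp only [← div_div]
      generalize 1-b*c*U^2 = e0
      generalize 1-b*c*q*U^2 = e1
      generalize 1-b*c*q^2*U^2 = e2
      generalize 1-a*b*c*q*W = e3
      ring

theorem pP {q s t a b c : ℂ} {L : ℕ} (g : Good q a b c L) (hv : (s*t)^2 = q*b) (M n x : ℕ) (hM : M+1 ≤ L)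
    (hn : n ≤ M+1) (hx : x ≤ M) :
    lamP q a b c M x * p q s a b c t ((M:ℤ)+1) n x = PhiPp q (s*t) a b c M ((n:ℤ)+1) * p q s a b c t M ((n:ℤ)+1) x
      + PhiP0 q (s*t) a b c M n * p q s a b c t M n x
      + PhiPm q (s*t) a b c M ((n:ℤ)-1) * p q s a b c t M ((n:ℤ)-1) x := by
  have hq := g.q0
  have hl : lamP q a b c M x = lamn q (a*b) x - muP q a b c (q^M) := by
    have hU : q^x ≠ 0 := pow_ne_zero _ hq
    have hW : q^M ≠ 0 := pow_ne_zero _ hq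
    have hc := g.c0
    simp only [lamP, lamn, muP, zpow_add₀ hq, zpow_sub₀ hq, zpow_neg, zpow_one, zpow_natCast, pow_succ q x, zpow_ofNat]
    field_simp
    ring
  rw [show ((M:ℤ)+1) = ((M+1:ℕ):ℤ) by push_cast; ring, p_eq q s a b c t hq (M+1) n x (by omega), hl]
  refine comb q s t a b c _ (gP q a b c (q^n) (q^M)) (-muP q a b c (q^M) - gP q a b c (q^n) (q^M) - gM q a b c (q^n) (q^M))
    (gM q a b c (q^n) (q^M)) _ _ _ hq (M+1) M n x hx _ ?_ ?_ ?_ ?_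
  · exact recP g M n x hM hn hx
  · exact recPp_O g hv M n hM hn
  · exact recP0_O g hv M n hM hn
  · rintro m rfl
    have := recPm_O g hv M m hM (by omega)
    rw [show (((m+1:ℕ):ℤ)-1) = ((m:ℕ):ℤ) by push_cast; ring, this]

theorem pM {q s t a b c : ℂ} {L : ℕ} (g : Good q a b c L) (hv : (s*t)^2 = q*b) (l n x : ℕ) (hLl : l+1 ≤ L)
    (hn : n ≤ l) (hx : x ≤ l+1) :
    lamM q a b c ((l:ℤ)+1) x * p q s a b c t l n x = PhiMp q (s*t) a b c ((l:ℤ)+1) ((n:ℤ)+1) * p q s a b c t ((l:ℤ)+1) ((n:ℤ)+1) x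
      + PhiM0 q (s*t) a b c ((l:ℤ)+1) n * p q s a b c t ((l:ℤ)+1) n x
      + PhiMm q (s*t) a b c ((l:ℤ)+1) ((n:ℤ)-1) * p q s a b c t ((l:ℤ)+1) ((n:ℤ)-1) x := by
  have hq := g.q0
  have hl : lamM q a b c ((l+1:ℕ):ℤ) x = lamn q (a*b) x - lamn q (a*b) (l+1) := by
    have hU : q^x ≠ 0 := pow_ne_zero _ hq
    have hW : q^(l+1) ≠ 0 := pow_ne_zero _ hq
    simp only [lamM, lamn, zpow_add₀ hq, zpow_neg, zpow_one, zpow_natCast, pow_succ q x, pow_succ q (l+1)]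
    field_simp
    ring
  have key : lamM q a b c ((l:ℤ)+1) x * p q s a b c t l n x = (lamn q (a*b) x - lamn q (a*b) (l+1)) * (Omn q (s*t) a b c l n * Rr q a b c l n x) := by
    rw [show ((l:ℤ)+1) = ((l+1:ℕ):ℤ) by push_cast; ring, hl]
    rcases Nat.lt_or_ge l x with h | h
    · rw [show x = l+1 by omega]; ring
    · rw [p_eq q s a b c t hq l n x (by omega)]
  rw [key, show ((l:ℤ)+1) = ((l+1:ℕ):ℤ) by push_cast; ring]
  refine comb q s t a b c _ (hP q a b c (q^n) (q^(l+1))) (-lamn q (a*b) (l+1) - hP q a b c (q^n) (q^(l+1)) - hM q a b c (q^n) (q^(l+1)))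
    (hM q a b c (q^n) (q^(l+1))) _ _ _ hq l (l+1) n x hx _ ?_ ?_ ?_ ?_
  · exact recM g l n x hLl hn
  · exact recMp_O g hv l n hLl hn
  · exact recM0_O g hv l n hLl hn
  · rintro m rfl
    have := recMm_O g hv l m hLl (by omega)
    rw [show (((m+1:ℕ):ℤ)-1) = ((m:ℕ):ℤ) by push_cast; ring, this]
end qR

namespace qR

theorem pRz {q s t a b c : ℂ} {L : ℕ} (g : Good q a b c L) (hv : (s*t)^2 = q*b) (M n x : ℤ) (hM : M ≤ L)
    (hn0 : 0 ≤ n) (hn : n ≤ M) (hx0 : 0 ≤ x) (hx : x ≤ M) :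
    lam q (a*b) x * p q s a b c t M n x = PhiP q a b c M (n+1) * p q s a b c t M (n+1) x
      + (-PhiP q a b c M n - PhiM q a b c M n) * p q s a b c t M n x
      + PhiM q a b c M (n-1) * p q s a b c t M (n-1) x := by
  lift M to ℕ using (by omega)
  lift n to ℕ using hn0
  lift x to ℕ using hx0
  exact pR g hv M n x (by omega) (by omega) (by omega)

theorem pPz {q s t a b c : ℂ} {L : ℕ} (g : Good q a b c L) (hv : (s*t)^2 = q*b) (M M' n x : ℤ) (hM : M+1 ≤ L)
    (hM' : M' = M+1) (hn0 : 0 ≤ n) (hn : n ≤ M+1) (hx0 : 0 ≤ x) (hx : x ≤ M) :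
    lamP q a b c M x * p q s a b c t M' n x = PhiPp q (s*t) a b c M (n+1) * p q s a b c t M (n+1) x
      + PhiP0 q (s*t) a b c M n * p q s a b c t M n x
      + PhiPm q (s*t) a b c M (n-1) * p q s a b c t M (n-1) x := by
  subst hM'
  lift M to ℕ using (by omega)
  lift n to ℕ using hn0
  lift x to ℕ using hx0
  exact pP g hv M n x (by omega) (by omega) (by omega)

theorem pMz {q s t a b c : ℂ} {L : ℕ} (g : Good q a b c L) (hv : (s*t)^2 = q*b) (l M n x : ℤ) (hL : l+1 ≤ L)
    (hM' : M = l+1) (hn0 : 0 ≤ n) (hn : n ≤ l) (hx0 : 0 ≤ x) (hx : x ≤ l+1) :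
    lamM q a b c M x * p q s a b c t l n x = PhiMp q (s*t) a b c M (n+1) * p q s a b c t M (n+1) x
      + PhiM0 q (s*t) a b c M n * p q s a b c t M n x
      + PhiMm q (s*t) a b c M (n-1) * p q s a b c t M (n-1) x := by
  subst hM'
  lift l to ℕ using (by omega)
  lift n to ℕ using hn0
  lift x to ℕ using hx0
  exact pM g hv l n x (by omega) (by omega) (by omega)

theorem sum3 (f : ℤ → ℂ) : ∑ ε ∈ ({-1, 0, 1} : Finset ℤ), f ε = f (-1) + f 0 + f 1 := by
  rw [Finset.sum_insert (by decide), Finset.sum_insert (by decide), Finset.sum_singleton]; ring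

theorem sum2 (f : ℤ → ℂ) : ∑ ε ∈ ({-1, 1} : Finset ℤ), f ε = f (-1) + f 1 := by
  rw [Finset.sum_insert (by decide), Finset.sum_singleton]

theorem T_eq (q s c1 c2 c3 c4 c0 t1 t2 t3 t4 t0 : ℂ) (N i j x y : ℤ)
    (hc0 : c0 = (q ^ (2 * N + 3) * c1 * c2 * c3 * c4)⁻¹)
    (ht0 : t0 = (s ^ (2 * N + 3) * t1 * t2 * t3 * t4)⁻¹) :
    T q s c1 c2 c3 c4 t1 t2 t3 t4 N i j x y
      = p q s c1 c2 c3 t2 (N - j) i x * p q s c3 c0 c4 t0 (N - x) j y := by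
  unfold T
  split_ifs with h
  · rw [← hc0, ← ht0]
  · by_cases hj : 0 ≤ j
    · rw [p_zero q s c1 c2 c3 t2 (N-j) i x (by omega), zero_mul]
    · rw [p_zero q s c3 c0 c4 t0 (N-x) j y (by omega), mul_zero]

theorem inv_pair (A B : ℂ) (h : A*B = 1) : 1 - A = -A*(1-B) := by linear_combination -h

theorem Ip (q c1 c2 c3 c4 c0 : ℂ) (hq : q ≠ 0) (hc1 : c1 ≠ 0) (hc2 : c2 ≠ 0) (hc3 : c3 ≠ 0) (hc4 : c4 ≠ 0)
    (N n x : ℤ) (hc0 : c0 = (q ^ (2 * N + 3) * c1 * c2 * c3 * c4)⁻¹) :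
    PhiP q c3 c0 c4 (N-x) n = -c3*q^(N+1)*Fp q c4 c0 n * lamP q c1 c2 c3 (N-n) x := by
  have hU : q^n ≠ 0 := zpow_ne_zero _ hq
  have hX : q^x ≠ 0 := zpow_ne_zero _ hq
  have hQ : q^N ≠ 0 := zpow_ne_zero _ hq
  have hc : c0*c4*(c1*c2*c3)*(q^N*q^N*q^3) = 1 := by
    rw [hc0, zpow_add₀ hq, z1 q hq, zpow_ofNat]; field_simp
  clear hc0
  have hk : (c0*c4*(q^n*(q^N/q^x)*q))*(c1*c2*c3*(q^N/q^n*q^x*q^2)) = 1 := by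
    field_simp; linear_combination hc
  rw [PhiP_eq q c3 c0 c4 hq (N-x) n (q^n) (q^N/q^x) rfl (zpow_sub₀ hq _ _)]
  have e1 : q^(-(N-n)-1) = q^n/q^N/q := by
    rw [show -(N-n)-1 = n - N - 1 by ring, zpow_sub₀ hq, zpow_sub₀ hq, zpow_one]
  simp only [Fp, lamP, e1, zpow_add₀ hq, zpow_sub₀ hq, zpow_neg, zpow_one, z1 q hq, zpow_ofNat, pow_one]
  rw [inv_pair _ _ hk]
  have e2 : 1 - c3*(q^N/q^x/q^n*q) = (c3*q^N*q/q^n)*(q^n/q^N/q/c3-(q^x)⁻¹) := by field_simp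
  rw [e2]
  generalize q^n/q^N/q/c3-(q^x)⁻¹ = f1
  generalize 1-c1*c2*c3*(q^N/q^n*q^x*q^2) = f2
  rw [show c4*c0 = c0*c4 by ring]
  generalize 1-c0*c4*(q^n*q^n) = k0
  generalize 1-c0*c4*(q^n*q^n*q) = k1
  generalize 1-q^n = f3
  generalize 1-c4*q^n = f4
  generalize q^n = U at *
  generalize q^x = X at *
  generalize q^N = Q at *
  have : -c0*(U/(Q/X))*(c3*Q*q/U)*(c0*c4*(U*(Q/X)*q)) = -(c4*c0^2)*(U*q)*(-c3*(Q*q))*(-1) := by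
    field_simp
  calc _ = (-c0*(U/(Q/X))*(c3*Q*q/U)*(c0*c4*(U*(Q/X)*q)))*(-(f3*f1*f2*f4/(k0*k1))) := by ring
    _ = _ := by rw [this]; ring

theorem Im (q c1 c2 c3 c4 c0 : ℂ) (hq : q ≠ 0) (hc1 : c1 ≠ 0) (hc2 : c2 ≠ 0) (hc3 : c3 ≠ 0) (hc4 : c4 ≠ 0)
    (N n x : ℤ) (hc0 : c0 = (q ^ (2 * N + 3) * c1 * c2 * c3 * c4)⁻¹) :
    PhiM q c3 c0 c4 (N-x) n = -c3*q^(N+1)*Fm q c4 c0 n * lamM q c1 c2 c3 (N-n) x := by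
  have hU : q^n ≠ 0 := zpow_ne_zero _ hq
  have hX : q^x ≠ 0 := zpow_ne_zero _ hq
  have hQ : q^N ≠ 0 := zpow_ne_zero _ hq
  have hc : c0*c4*(c1*c2*c3)*(q^N*q^N*q^3) = 1 := by
    rw [hc0, zpow_add₀ hq, z1 q hq, zpow_ofNat]; field_simp
  clear hc0
  have hk : (c3*c0*c4*(q^n*(q^N/q^x)*q^2))*(c1*c2*(q^N/q^n*q^x*q)) = 1 := by
    field_simp; linear_combination hc
  rw [PhiM_eq q c3 c0 c4 hq (N-x) n (q^n) (q^N/q^x) rfl (zpow_sub₀ hq _ _)]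
  have e1 : q^(-(N-n)) = q^n/q^N := by
    rw [show -(N-n) = n - N by ring, zpow_sub₀ hq]
  simp only [Fm, lamM, e1, zpow_add₀ hq, zpow_sub₀ hq, zpow_neg, zpow_one, z1 q hq, zpow_ofNat, pow_one]
  rw [inv_pair _ _ hk]
  have e2 : 1 - q^n/(q^N/q^x) = -q^x*(q^n/q^N-(q^x)⁻¹) := by field_simp; ring
  rw [e2]
  generalize q^n/q^N-(q^x)⁻¹ = f1
  generalize 1-c1*c2*(q^N/q^n*q^x*q) = f2
  rw [show c4*c0 = c0*c4 by ring]
  generalize 1-c0*c4*(q^n*q^n*q) = k0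
  generalize 1-c0*c4*(q^n*q^n*q^2) = k1
  generalize 1-c0*(q^n*q) = f3
  generalize 1-c0*c4*(q^n*q) = f4
  generalize q^n = U at *
  generalize q^x = X at *
  generalize q^N = Q at *
  have : X*(c3*c0*c4*(U*(Q/X)*q^2)) = (c0*c4)*(U*q)*(c3*(Q*q)) := by
    field_simp
  calc _ = (X*(c3*c0*c4*(U*(Q/X)*q^2)))*((f3*f1*f2*f4/(k0*k1))) := by ring
    _ = _ := by rw [this]; ring

theorem mk_good {q a b c : ℂ} {L : ℕ} (q0 : q ≠ 0) (a0 : a ≠ 0) (b0 : b ≠ 0) (c0 : c ≠ 0)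
    (h1 : ∀ k : ℕ, 1 ≤ k → k ≤ L → q ^ k ≠ 1)
    (ha : ∀ k : ℤ, 0 ≤ k → k ≤ 2*(L:ℤ)+5 → a ≠ q^(-k))
    (hb : ∀ k : ℤ, 0 ≤ k → k ≤ 2*(L:ℤ)+5 → b ≠ q^(-k))
    (hc : ∀ k : ℤ, 0 ≤ k → k ≤ 2*(L:ℤ)+5 → c ≠ q^(-k))
    (hbc : ∀ k : ℤ, 0 ≤ k → k ≤ 2*(L:ℤ)+5 → b*c ≠ q^(-k))
    (habc : ∀ k : ℤ, 0 ≤ k → k ≤ 2*(L:ℤ)+5 → a*b*c ≠ q^(-k)) : Good q a b c L := by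
  have key : ∀ z : ℂ, (∀ k : ℤ, 0 ≤ k → k ≤ 2*(L:ℤ)+5 → z ≠ q^(-k)) → ∀ k : ℕ, k ≤ 2*L+5 → 1 - z*q^k ≠ 0 := by
    intro z hz k hk h
    apply hz k (by omega) (by omega)
    rw [zpow_neg, zpow_natCast]
    exact eq_inv_of_mul_eq_one_left (by linear_combination -h)
  refine ⟨q0, a0, b0, c0, fun k hk hk' h => h1 k hk hk' (by linear_combination -h), key a ha, key b hb, key c hc, key _ hbc, key _ habc⟩

end qR

namespace qR

theorem part1 {q s t a b c : ℂ} {L : ℕ} (g : Good q a b c L) (hv : (s*t)^2 = q*b) (N i j x : ℤ) (hN : N ≤ L)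
    (hi : 0 ≤ i) (hij : i + j ≤ N ∧ 0 ≤ j) (hx0 : 0 ≤ x) (P : ℂ) :
    lam q (a*b) x * (p q s a b c t (N-j) i x * P) =
      Phi q a b c (N-j) (-1) (i + -1) * (p q s a b c t (N-j) (i + -1) x * P)
      + Phi q a b c (N-j) 0 (i+0) * (p q s a b c t (N-j) (i+0) x * P)
      + Phi q a b c (N-j) 1 (i+1) * (p q s a b c t (N-j) (i+1) x * P) := by
  have hp1 : Phi q a b c (N-j) (-1) (i + -1) = PhiM q a b c (N-j) (i-1) := by
    simp [Phi, sub_eq_add_neg]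
  have hp0 : Phi q a b c (N-j) 0 (i + 0) = -PhiP q a b c (N-j) i - PhiM q a b c (N-j) i := by
    simp [Phi]
  have hp2 : Phi q a b c (N-j) 1 (i + 1) = PhiP q a b c (N-j) (i+1) := by
    simp [Phi]
  rw [hp1, hp0, hp2, add_zero, ← sub_eq_add_neg]
  by_cases hx : x ≤ N - j
  · linear_combination P * pRz g hv (N-j) i x (by omega) hi (by omega) hx0 hx
  · rw [p_zero q s a b c t (N-j) i x (by omega), p_zero q s a b c t (N-j) (i-1) x (by omega),
      p_zero q s a b c t (N-j) (i+1) x (by omega)]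
    ring

/-- The central coefficient. -/
theorem A00 (q s c1 c2 c3 c4 c0 t2 : ℂ) (hq : q ≠ 0) (hv : s*t2 ≠ 0) (hc3 : c3 ≠ 0) (N i j : ℤ)
    (hc0 : c0 = (q ^ (2 * N + 3) * c1 * c2 * c3 * c4)⁻¹)
    (h12 : 1 - c1*c2*q^(N+2-j) ≠ 0) (h3 : 1 - c3*q^(N-j) ≠ 0) :
    A q s c1 c2 c3 c4 t2 N 0 0 i j =
      -(c3*q^(N+1)*Fp q c4 c0 j * ((1-c3*q^(N-j)*q)*(1-c1*c2*c3*q^(N-j)*q^2)/(c3*q^(N-j)*q)))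
      -(c3*q^(N+1)*Fm q c4 c0 j * ((1-c1*c2*q^(N-j)*q)*((q^(N-j))⁻¹-1)))
      - c3*q^(N+1)*(Fp q c4 c0 j + Fm q c4 c0 j) * (PhiP q c1 c2 c3 (N-j) i + PhiM q c1 c2 c3 (N-j) i) := by
  have hW : q^(N-j) ≠ 0 := zpow_ne_zero _ hq
  have e1 : q^(N+1-j) = q^(N-j)*q := by
    rw [show N+1-j = N-j+1 by ring, zpow_add₀ hq, zpow_one]
  have e2 : q^(N+2-j) = q^(N-j)*q^2 := by
    rw [show N+2-j = N-j+2 by ring, zpow_add₀ hq, zpow_ofNat]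
  rw [e2] at h12
  simp only [A, Aaux, sum3, sum2, ← hc0, PhiC, Phi]
  norm_num
  rw [PhiP0_eq q (s*t2) c1 c2 c3 hq (N-j) i _ rfl, PhiM0_eq q (s*t2) c1 c2 c3 (N-j) i _ rfl, e1, e2]
  generalize PhiPp q (s*t2) c1 c2 c3 (N-j) i = a1
  generalize PhiPm q (s*t2) c1 c2 c3 (N-j) i = a2
  generalize PhiMp q (s*t2) c1 c2 c3 (N-j) i = a3
  generalize PhiMm q (s*t2) c1 c2 c3 (N-j) i = a4
  generalize PhiP q c1 c2 c3 (N-j) i = a5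
  generalize PhiM q c1 c2 c3 (N-j) i = a6
  generalize Fp q c4 c0 j = F
  generalize Fm q c4 c0 j = G
  generalize q^(N+1) = K
  generalize q^(N-j) = W at *
  generalize s*t2 = v at *
  have r1 : (1-c3*(W*q))*v/(1-c1*c2*(W*q^2)) * ((1-c1*c2*(W*q^2))*(1-c1*c2*c3*(W*q^2))/(c3*(W*q)*v))
     = (1-c3*W*q)*(1-c1*c2*c3*W*q^2)/(c3*W*q) := by
    rw [show (1-c3*(W*q))*v/(1-c1*c2*(W*q^2)) * ((1-c1*c2*(W*q^2))*(1-c1*c2*c3*(W*q^2))/(c3*(W*q)*v))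
      = ((1-c1*c2*(W*q^2))/(1-c1*c2*(W*q^2)))*(v/v)*((1-c3*(W*q))*(1-c1*c2*c3*(W*q^2))/(c3*(W*q))) by ring,
      div_self h12, div_self hv]
    ring
  have r2 : (1-c1*c2*(W*q))/((1-c3*W)*v) * (v*(1-c3*W)*(W⁻¹-1)) = (1-c1*c2*W*q)*(W⁻¹-1) := by
    generalize 1-c3*W = d at *
    rw [show (1-c1*c2*(W*q))/(d*v) * (v*d*(W⁻¹-1))
      = (d/d)*(v/v)*((1-c1*c2*(W*q))*(W⁻¹-1)) by ring, div_self h3, div_self hv]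
    ring
  rw [← r1, ← r2]
  ring

theorem lamP_lam (q c1 c2 c3 : ℂ) (hq : q ≠ 0) (hc3 : c3 ≠ 0) (M x : ℤ) :
    lamP q c1 c2 c3 M x = lam q (c1*c2) x - (1-c3*q^M*q)*(1-c1*c2*c3*q^M*q^2)/(c3*q^M*q) := by
  have hW : q^M ≠ 0 := zpow_ne_zero _ hq
  have hX : q^x ≠ 0 := zpow_ne_zero _ hq
  simp only [lamP, lam, zpow_add₀ hq, zpow_sub₀ hq, zpow_neg, zpow_one, zpow_ofNat]
  field_simp; ring

theorem lamM_lam (q c1 c2 c3 : ℂ) (hq : q ≠ 0) (M x : ℤ) :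
    lamM q c1 c2 c3 M x = lam q (c1*c2) x - (1-c1*c2*q^M*q)*((q^M)⁻¹-1) := by
  have hW : q^M ≠ 0 := zpow_ne_zero _ hq
  have hX : q^x ≠ 0 := zpow_ne_zero _ hq
  simp only [lamM, lam, zpow_add₀ hq, zpow_sub₀ hq, zpow_neg, zpow_one, zpow_ofNat]
  field_simp; ring

theorem part2 {q s c1 c2 c3 c4 c0 t0 t2 : ℂ} {N : ℕ} (g1 : Good q c1 c2 c3 N) (g2 : Good q c3 c0 c4 N)
    (hv2 : (s*t2)^2 = q*c2) (hv0 : (s*t0)^2 = q*c0) (hv : s*t2 ≠ 0)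
    (hc0 : c0 = (q ^ (2 * (N:ℤ) + 3) * c1 * c2 * c3 * c4)⁻¹)
    (i j x y : ℕ) (hij : i + j ≤ N) (hxy : x + y ≤ N)
    (h12 : 1 - c1*c2*q^((N:ℤ)+2-j) ≠ 0) (h3 : 1 - c3*q^((N:ℤ)-j) ≠ 0) :
    lam q (c3 * c0) y * (p q s c1 c2 c3 t2 (N-j) i x * p q s c3 c0 c4 t0 (N-x) j y) =
    (A q s c1 c2 c3 c4 t2 N (-1) (-1) (i + -1) (j + -1) * (p q s c1 c2 c3 t2 (N-(j + -1)) (i + -1) x * p q s c3 c0 c4 t0 (N-x) (j + -1) y)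
    + A q s c1 c2 c3 c4 t2 N (-1) 0 (i + -1) (j + 0) * (p q s c1 c2 c3 t2 (N-(j + 0)) (i + -1) x * p q s c3 c0 c4 t0 (N-x) (j + 0) y)
    + A q s c1 c2 c3 c4 t2 N (-1) 1 (i + -1) (j + 1) * (p q s c1 c2 c3 t2 (N-(j + 1)) (i + -1) x * p q s c3 c0 c4 t0 (N-x) (j + 1) y))
    + (A q s c1 c2 c3 c4 t2 N 0 (-1) (i + 0) (j + -1) * (p q s c1 c2 c3 t2 (N-(j + -1)) (i + 0) x * p q s c3 c0 c4 t0 (N-x) (j + -1) y)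
    + A q s c1 c2 c3 c4 t2 N 0 0 (i + 0) (j + 0) * (p q s c1 c2 c3 t2 (N-(j + 0)) (i + 0) x * p q s c3 c0 c4 t0 (N-x) (j + 0) y)
    + A q s c1 c2 c3 c4 t2 N 0 1 (i + 0) (j + 1) * (p q s c1 c2 c3 t2 (N-(j + 1)) (i + 0) x * p q s c3 c0 c4 t0 (N-x) (j + 1) y))
    + (A q s c1 c2 c3 c4 t2 N 1 (-1) (i + 1) (j + -1) * (p q s c1 c2 c3 t2 (N-(j + -1)) (i + 1) x * p q s c3 c0 c4 t0 (N-x) (j + -1) y)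
    + A q s c1 c2 c3 c4 t2 N 1 0 (i + 1) (j + 0) * (p q s c1 c2 c3 t2 (N-(j + 0)) (i + 1) x * p q s c3 c0 c4 t0 (N-x) (j + 0) y)
    + A q s c1 c2 c3 c4 t2 N 1 1 (i + 1) (j + 1) * (p q s c1 c2 c3 t2 (N-(j + 1)) (i + 1) x * p q s c3 c0 c4 t0 (N-x) (j + 1) y)) := by
  have hq := g1.q0
  have hc3 := g1.c0
  have hc4 := g2.c0
  simp only [add_zero, ← sub_eq_add_neg]
  set pi := p q s c1 c2 c3 t2 (N-j) i x with hpi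
  have key1 : A q s c1 c2 c3 c4 t2 N (-1) 1 (i-1) (j+1) * (p q s c1 c2 c3 t2 (N-(j + 1)) (i-1) x * p q s c3 c0 c4 t0 (N-x) (j + 1) y)
     + A q s c1 c2 c3 c4 t2 N 0 1 i (j+1) * (p q s c1 c2 c3 t2 (N-(j + 1)) i x * p q s c3 c0 c4 t0 (N-x) (j + 1) y)
     + A q s c1 c2 c3 c4 t2 N 1 1 (i+1) (j+1) * (p q s c1 c2 c3 t2 (N-(j + 1)) (i+1) x * p q s c3 c0 c4 t0 (N-x) (j + 1) y)
     = PhiP q c3 c0 c4 (N-x) (j+1) * (pi * p q s c3 c0 c4 t0 (N-x) (j + 1) y) := by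
    by_cases h : (j:ℤ) + 1 ≤ N - x
    · have a1 : A q s c1 c2 c3 c4 t2 N (-1) 1 (i-1) (j+1) = -c3*q^((N:ℤ)+1)*Fp q c4 c0 (j+1) * PhiPm q (s*t2) c1 c2 c3 (N-(j+1)) (i-1) := by
        simp [A, Aaux, PhiC, ← hc0]
      have a2 : A q s c1 c2 c3 c4 t2 N 0 1 i (j+1) = -c3*q^((N:ℤ)+1)*Fp q c4 c0 (j+1) * PhiP0 q (s*t2) c1 c2 c3 (N-(j+1)) i := by
        simp [A, Aaux, PhiC, ← hc0]
      have a3 : A q s c1 c2 c3 c4 t2 N 1 1 (i+1) (j+1) = -c3*q^((N:ℤ)+1)*Fp q c4 c0 (j+1) * PhiPp q (s*t2) c1 c2 c3 (N-(j+1)) (i+1) := by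
        simp [A, Aaux, PhiC, ← hc0]
      rw [a1, a2, a3, Ip q c1 c2 c3 c4 c0 hq g1.a0 g1.b0 hc3 hc4 N (j+1) x hc0]
      linear_combination c3*q^((N:ℤ)+1)*Fp q c4 c0 (j+1) * p q s c3 c0 c4 t0 (N-x) (j + 1) y *
        pPz g1 hv2 (N-(j+1)) (N-j) i x (by omega) (by omega) (by omega) (by omega) (by omega) (by omega)
    · rw [p_zero q s c3 c0 c4 t0 (N-x) (j + 1) y (by omega)]; ring
  have key2 : A q s c1 c2 c3 c4 t2 N (-1) (-1) (i-1) (j-1) * (p q s c1 c2 c3 t2 (N-(j - 1)) (i-1) x * p q s c3 c0 c4 t0 (N-x) (j - 1) y)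
     + A q s c1 c2 c3 c4 t2 N 0 (-1) i (j-1) * (p q s c1 c2 c3 t2 (N-(j - 1)) i x * p q s c3 c0 c4 t0 (N-x) (j - 1) y)
     + A q s c1 c2 c3 c4 t2 N 1 (-1) (i+1) (j-1) * (p q s c1 c2 c3 t2 (N-(j - 1)) (i+1) x * p q s c3 c0 c4 t0 (N-x) (j - 1) y)
     = PhiM q c3 c0 c4 (N-x) (j-1) * (pi * p q s c3 c0 c4 t0 (N-x) (j - 1) y) := by
    by_cases h : (j:ℤ) - 1 ≤ N - x ∧ 1 ≤ (j:ℤ)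
    · have a1 : A q s c1 c2 c3 c4 t2 N (-1) (-1) (i-1) (j-1) = -c3*q^((N:ℤ)+1)*Fm q c4 c0 (j-1) * PhiMm q (s*t2) c1 c2 c3 (N-(j-1)) (i-1) := by
        simp [A, Aaux, PhiC, ← hc0]
      have a2 : A q s c1 c2 c3 c4 t2 N 0 (-1) i (j-1) = -c3*q^((N:ℤ)+1)*Fm q c4 c0 (j-1) * PhiM0 q (s*t2) c1 c2 c3 (N-(j-1)) i := by
        simp [A, Aaux, PhiC, ← hc0]
      have a3 : A q s c1 c2 c3 c4 t2 N 1 (-1) (i+1) (j-1) = -c3*q^((N:ℤ)+1)*Fm q c4 c0 (j-1) * PhiMp q (s*t2) c1 c2 c3 (N-(j-1)) (i+1) := by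
        simp [A, Aaux, PhiC, ← hc0]
      rw [a1, a2, a3, Im q c1 c2 c3 c4 c0 hq g1.a0 g1.b0 hc3 hc4 N (j-1) x hc0]
      linear_combination c3*q^((N:ℤ)+1)*Fm q c4 c0 (j-1) * p q s c3 c0 c4 t0 (N-x) (j - 1) y *
        pMz g1 hv2 (N-j) (N-(j-1)) i x (by omega) (by omega) (by omega) (by omega) (by omega) (by omega)
    · rw [p_zero q s c3 c0 c4 t0 (N-x) (j - 1) y (by omega)]; ring
  have key0 : A q s c1 c2 c3 c4 t2 N (-1) 0 (i-1) j * (p q s c1 c2 c3 t2 (N-j) (i-1) x * p q s c3 c0 c4 t0 (N-x) j y)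
     + A q s c1 c2 c3 c4 t2 N 0 0 i j * (pi * p q s c3 c0 c4 t0 (N-x) j y)
     + A q s c1 c2 c3 c4 t2 N 1 0 (i+1) j * (p q s c1 c2 c3 t2 (N-j) (i+1) x * p q s c3 c0 c4 t0 (N-x) j y)
     = (-PhiP q c3 c0 c4 (N-x) j - PhiM q c3 c0 c4 (N-x) j) * (pi * p q s c3 c0 c4 t0 (N-x) j y) := by
    by_cases h : (j:ℤ) ≤ N - x
    · have a1 : A q s c1 c2 c3 c4 t2 N (-1) 0 (i-1) j = c3*q^((N:ℤ)+1)*(Fp q c4 c0 j + Fm q c4 c0 j) * PhiM q c1 c2 c3 (N-j) (i-1) := by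
        simp [A, Aaux, Phi, ← hc0]
      have a3 : A q s c1 c2 c3 c4 t2 N 1 0 (i+1) j = c3*q^((N:ℤ)+1)*(Fp q c4 c0 j + Fm q c4 c0 j) * PhiP q c1 c2 c3 (N-j) (i+1) := by
        simp [A, Aaux, Phi, ← hc0]
      rw [a1, a3, A00 q s c1 c2 c3 c4 c0 t2 hq hv hc3 N i j hc0 h12 h3,
        Ip q c1 c2 c3 c4 c0 hq g1.a0 g1.b0 hc3 hc4 N j x hc0,
        Im q c1 c2 c3 c4 c0 hq g1.a0 g1.b0 hc3 hc4 N j x hc0,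
        lamP_lam q c1 c2 c3 hq hc3, lamM_lam q c1 c2 c3 hq]
      have := pRz g1 hv2 (N-j) i x (by omega) (by omega) (by omega) (by omega) (by omega)
      rw [← hpi] at this
      generalize (1-c3*q^((N:ℤ)-j)*q)*(1-c1*c2*c3*q^((N:ℤ)-j)*q^2)/(c3*q^((N:ℤ)-j)*q) = r1
      generalize (1-c1*c2*q^((N:ℤ)-j)*q)*((q^((N:ℤ)-j))⁻¹-1) = r2
      linear_combination (-c3*q^((N:ℤ)+1)*(Fp q c4 c0 j + Fm q c4 c0 j) * p q s c3 c0 c4 t0 (N-x) j y) * this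
    · rw [p_zero q s c3 c0 c4 t0 (N-x) j y (by omega)]; ring
  have fin : lam q (c3*c0) y * (pi * p q s c3 c0 c4 t0 (N-x) j y) =
      PhiP q c3 c0 c4 (N-x) (j+1) * (pi * p q s c3 c0 c4 t0 (N-x) (j + 1) y)
      + (-PhiP q c3 c0 c4 (N-x) j - PhiM q c3 c0 c4 (N-x) j) * (pi * p q s c3 c0 c4 t0 (N-x) j y)
      + PhiM q c3 c0 c4 (N-x) (j-1) * (pi * p q s c3 c0 c4 t0 (N-x) (j - 1) y) := by
    by_cases h : (j:ℤ) ≤ N - x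
    · linear_combination pi * pRz g2 hv0 (N-x) j y (by omega) (by omega) (by omega) (by omega) (by omega)
    · rw [hpi, p_zero q s c1 c2 c3 t2 (N-j) i x (by omega)]; ring
  rw [fin]
  linear_combination -key1 - key2 - key0

end qR

/-- Recurrence relations of the Tratnik polynomials of q-Racah type. -/
theorem tratnik_recurrences
    (N : ℕ) (q s c1 c2 c3 c4 c0 t1 t2 t3 t4 t0 : ℂ)
    (hq : q ≠ 0) (hc1 : c1 ≠ 0) (hc2 : c2 ≠ 0) (hc3 : c3 ≠ 0) (hc4 : c4 ≠ 0)
    (hs : s ^ 2 = q) (ht1 : t1 ^ 2 = c1) (ht2 : t2 ^ 2 = c2) (ht3 : t3 ^ 2 = c3)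
    (ht4 : t4 ^ 2 = c4)
    (hc0 : c0 = (q ^ (2 * (N : ℤ) + 3) * c1 * c2 * c3 * c4)⁻¹)
    (ht0 : t0 = (s ^ (2 * (N : ℤ) + 3) * t1 * t2 * t3 * t4)⁻¹)
    (hgen : ∀ e0 e1 e2 e3 e4 : ℕ, e0 ≤ 1 → e1 ≤ 1 → e2 ≤ 1 → e3 ≤ 1 → e4 ≤ 1 →
      1 ≤ e0 + e1 + e2 + e3 + e4 → e0 + e1 + e2 + e3 + e4 ≤ 4 →
      ∀ k : ℤ, 0 ≤ k → k ≤ 2 * (N : ℤ) + 5 →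
        c0 ^ e0 * c1 ^ e1 * c2 ^ e2 * c3 ^ e3 * c4 ^ e4 ≠ q ^ (-k))
    (hq1 : ∀ k : ℕ, 1 ≤ k → k ≤ N → q ^ k ≠ 1)
    (i j x y : ℕ) (hij : i + j ≤ N) (hxy : x + y ≤ N) :
    (qR.lam q (c1 * c2) (x : ℤ)
          * qR.T q s c1 c2 c3 c4 t1 t2 t3 t4 (N : ℤ) (i : ℤ) (j : ℤ) (x : ℤ) (y : ℤ)
        = ∑ ε ∈ ({-1, 0, 1} : Finset ℤ),
            qR.Phi q c1 c2 c3 ((N : ℤ) - (j : ℤ)) ε ((i : ℤ) + ε)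
              * qR.T q s c1 c2 c3 c4 t1 t2 t3 t4 (N : ℤ) ((i : ℤ) + ε) (j : ℤ) (x : ℤ) (y : ℤ))
    ∧
    (qR.lam q (c3 * c0) (y : ℤ)
          * qR.T q s c1 c2 c3 c4 t1 t2 t3 t4 (N : ℤ) (i : ℤ) (j : ℤ) (x : ℤ) (y : ℤ)
        = ∑ ε ∈ ({-1, 0, 1} : Finset ℤ), ∑ ε' ∈ ({-1, 0, 1} : Finset ℤ),
            qR.A q s c1 c2 c3 c4 t2 (N : ℤ) ε ε' ((i : ℤ) + ε) ((j : ℤ) + ε')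
              * qR.T q s c1 c2 c3 c4 t1 t2 t3 t4 (N : ℤ) ((i : ℤ) + ε) ((j : ℤ) + ε')
                  (x : ℤ) (y : ℤ)) := by
  have hs0 : s ≠ 0 := by rintro rfl; apply hq; rw [← hs]; ring
  have ht20 : t2 ≠ 0 := by rintro rfl; apply hc2; rw [← ht2]; ring
  have hc00 : c0 ≠ 0 := by
    rw [hc0]; apply inv_ne_zero
    exact mul_ne_zero (mul_ne_zero (mul_ne_zero (mul_ne_zero (zpow_ne_zero _ hq) hc1) hc2) hc3) hc4
  have ht02 : t0^2 = c0 := by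
    rw [ht0, hc0, inv_pow]
    simp only [mul_pow]
    rw [ht1, ht2, ht3, ht4]
    congr 5
    rw [← hs, ← zpow_natCast (s ^ (2 * (N:ℤ) + 3)), ← zpow_mul, ← zpow_natCast s, ← zpow_mul]
    congr 1
    push_cast; ring
  have g1 : qR.Good q c1 c2 c3 N := by
    refine qR.mk_good hq hc1 hc2 hc3 hq1 ?_ ?_ ?_ ?_ ?_
    · intro k h0 h; simpa using hgen 0 1 0 0 0 (by decide) (by decide) (by decide) (by decide) (by decide) (by decide) (by decide) k h0 h
    · intro k h0 h; simpa using hgen 0 0 1 0 0 (by decide) (by decide) (by decide) (by decide) (by decide) (by decide) (by decide) k h0 h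
    · intro k h0 h; simpa using hgen 0 0 0 1 0 (by decide) (by decide) (by decide) (by decide) (by decide) (by decide) (by decide) k h0 h
    · intro k h0 h; simpa using hgen 0 0 1 1 0 (by decide) (by decide) (by decide) (by decide) (by decide) (by decide) (by decide) k h0 h
    · intro k h0 h; simpa using hgen 0 1 1 1 0 (by decide) (by decide) (by decide) (by decide) (by decide) (by decide) (by decide) k h0 h
  have g2 : qR.Good q c3 c0 c4 N := by
    refine qR.mk_good hq hc3 hc00 hc4 hq1 ?_ ?_ ?_ ?_ ?_
    · intro k h0 h; simpa using hgen 0 0 0 1 0 (by decide) (by decide) (by decide) (by decide) (by decide) (by decide) (by decide) k h0 h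
    · intro k h0 h; simpa using hgen 1 0 0 0 0 (by decide) (by decide) (by decide) (by decide) (by decide) (by decide) (by decide) k h0 h
    · intro k h0 h; simpa using hgen 0 0 0 0 1 (by decide) (by decide) (by decide) (by decide) (by decide) (by decide) (by decide) k h0 h
    · intro k h0 h; simpa using hgen 1 0 0 0 1 (by decide) (by decide) (by decide) (by decide) (by decide) (by decide) (by decide) k h0 h
    · intro k h0 h; simpa [mul_comm c0 c3] using hgen 1 0 0 1 1 (by decide) (by decide) (by decide) (by decide) (by decide) (by decide) (by decide) k h0 h
  have h12 : ∀ k : ℤ, 0 ≤ k → k ≤ 2*(N:ℤ)+5 → 1 - c1*c2*q^k ≠ 0 := by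
    intro k h0 h he
    have h3 := hgen 0 1 1 0 0 (by decide) (by decide) (by decide) (by decide) (by decide) (by decide) (by decide) k h0 h
    apply h3
    rw [zpow_neg]
    exact eq_inv_of_mul_eq_one_left (by linear_combination -he)
  have h3 : ∀ k : ℤ, 0 ≤ k → k ≤ 2*(N:ℤ)+5 → 1 - c3*q^k ≠ 0 := by
    intro k h0 h he
    have h3 := hgen 0 0 0 1 0 (by decide) (by decide) (by decide) (by decide) (by decide) (by decide) (by decide) k h0 h
    apply h3
    rw [zpow_neg]
    exact eq_inv_of_mul_eq_one_left (by linear_combination -he)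
  have hv2 : (s*t2)^2 = q*c2 := by rw [mul_pow, hs, ht2]
  have hv0 : (s*t0)^2 = q*c0 := by rw [mul_pow, hs, ht02]
  have hv : s*t2 ≠ 0 := mul_ne_zero hs0 ht20
  constructor
  · rw [qR.sum3]
    simp only [qR.T_eq q s c1 c2 c3 c4 c0 t1 t2 t3 t4 t0 N _ _ _ _ hc0 ht0]
    exact qR.part1 g1 hv2 N i j x (by omega) (by omega) (by omega) (by omega) _
  · simp only [qR.sum3, qR.T_eq q s c1 c2 c3 c4 c0 t1 t2 t3 t4 t0 N _ _ _ _ hc0 ht0]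
    exact qR.part2 g1 g2 hv2 hv0 hv hc0 i j x y hij hxy (h12 _ (by omega) (by omega)) (h3 _ (by omega) (by omega))
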